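/- arXiv:2601.14193 — 8 statements merged into one kernel-verified Lean document; each statement's English description precedes it below -/
import Mathlib

section
/- Let Φ be a translation invariant curvature measure on ℝⁿ such that Φ(K, ℝⁿ) = 0 for every convex body K. Then for every convex body K, the vector (∫ x₁ dΦ(K,x), …, ∫ xₙ dΦ(K,x)) ∈ ℂⁿ lies in the complexification of the direction space of the affine hull of K, i.e., in the complex linear span of {y − z : y, z ∈ K} (these integrals are well defined since Φ(K,·) is supported in the compact set K). -/
open MeasureTheory Metric Filter Topology
open scoped Pointwise

/-- ℝⁿ as Euclidean space. -/
abbrev Rn (n : ℕ) := EuclideanSpace ℝ (Fin n)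

/-- A convex body: a nonempty compact convex subset of ℝⁿ. -/
def IsConvexBody {n : ℕ} (K : Set (Rn n)) : Prop :=
  K.Nonempty ∧ IsCompact K ∧ Convex ℝ K

/-- Integral of a complex-valued function against a finite complex Borel measure,
defined via the Jordan decompositions of the real and imaginary parts. -/
noncomputable def cmIntegral {n : ℕ} (μ : ComplexMeasure (Rn n)) (f : Rn n → ℂ) : ℂ :=
  ((∫ x, f x ∂(ComplexMeasure.re μ).toJordanDecomposition.posPart)
    - (∫ x, f x ∂(ComplexMeasure.re μ).toJordanDecomposition.negPart))
  + Complex.I * ((∫ x, f x ∂(ComplexMeasure.im μ).toJordanDecomposition.posPart)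
    - (∫ x, f x ∂(ComplexMeasure.im μ).toJordanDecomposition.negPart))

/-- The total variation measure of a finite complex Borel measure (a set is null for this
measure iff it is null for the classical total variation measure). -/
noncomputable def cmVariation {n : ℕ} (μ : ComplexMeasure (Rn n)) : Measure (Rn n) :=
  (ComplexMeasure.re μ).totalVariation + (ComplexMeasure.im μ).totalVariation

/-- A translation invariant curvature measure on ℝⁿ: a map assigning to each convex body
a finite complex Borel measure, which is local, translation invariant, and weakly continuous
with respect to Hausdorff convergence of convex bodies. -/
structure CurvatureMeasure (n : ℕ) where
  /-- the finite complex Borel measure associated to a convex body -/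
  meas : Set (Rn n) → ComplexMeasure (Rn n)
  locality : ∀ K L U : Set (Rn n), IsConvexBody K → IsConvexBody L → IsOpen U →
    K ∩ U = L ∩ U → ∀ β : Set (Rn n), MeasurableSet β → β ⊆ U → meas K β = meas L β
  translation_invariant : ∀ K : Set (Rn n), IsConvexBody K → ∀ x : Rn n,
    ∀ β : Set (Rn n), MeasurableSet β →
      meas ((fun y => y + x) '' K) ((fun y => y + x) '' β) = meas K β
  continuity : ∀ (Ki : ℕ → Set (Rn n)) (K : Set (Rn n)), (∀ i, IsConvexBody (Ki i)) →
    IsConvexBody K → Tendsto (fun i => hausdorffDist (Ki i) K) atTop (𝓝 0) →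
    ∀ f : BoundedContinuousFunction (Rn n) ℂ,
      Tendsto (fun i => cmIntegral (meas (Ki i)) f) atTop (𝓝 (cmIntegral (meas K) f))

/-- A curvature measure is homogeneous of degree `k`. -/
def CurvatureMeasure.Homogeneous {n : ℕ} (Φ : CurvatureMeasure n) (k : ℕ) : Prop :=
  ∀ t : ℝ, 0 < t → ∀ K : Set (Rn n), IsConvexBody K → ∀ β : Set (Rn n), MeasurableSet β →
    Φ.meas (t • K) (t • β) = (t : ℂ) ^ k * Φ.meas K β

/-- A curvature measure is SO(n) invariant: invariant under every orientation preserving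
linear isometry (rotation) of ℝⁿ. -/
def CurvatureMeasure.SOInvariant {n : ℕ} (Φ : CurvatureMeasure n) : Prop :=
  ∀ ρ : Rn n ≃ₗᵢ[ℝ] Rn n, 0 < LinearMap.det (ρ.toLinearEquiv : Rn n →ₗ[ℝ] Rn n) →
    ∀ K : Set (Rn n), IsConvexBody K → ∀ β : Set (Rn n), MeasurableSet β →
      Φ.meas (ρ '' K) (ρ '' β) = Φ.meas K β

lemma isConvexBody_singleton' {n : ℕ} (y : Rn n) : IsConvexBody ({y} : Set (Rn n)) :=
  ⟨Set.singleton_nonempty y, isCompact_singleton, convex_singleton y⟩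

lemma const_hasSum_zero {a b : ℂ} (h : HasSum (fun _ : ℕ => a) b) : a = 0 := by
  have := h.summable.tendsto_atTop_zero
  exact tendsto_nhds_unique tendsto_const_nhds this

lemma meas_zero_bounded {n : ℕ} [NeZero n] (Φ : CurvatureMeasure n) (β : Set (Rn n))
    (hβ : MeasurableSet β) (R : ℝ) (hR0 : 0 < R) (hR : ∀ x ∈ β, ‖x‖ < R) (h0 : (0 : Rn n) ∉ β) :
    Φ.meas {0} β = 0 := by
  obtain ⟨e, he⟩ : ∃ e : Rn n, ‖e‖ = 2 * R :=
    ⟨EuclideanSpace.single 0 (2 * R), by simp [abs_of_pos hR0]⟩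
  have key : ∀ k : ℕ, Φ.meas {0} ((fun y => y + ((k : ℝ) + 1) • e) '' β) = Φ.meas {0} β := by
    intro k
    set x : Rn n := ((k : ℝ) + 1) • e with hx
    have hxn : R < ‖x‖ := by
      rw [hx, norm_smul, he, Real.norm_of_nonneg (by positivity)]
      nlinarith [(Nat.cast_nonneg k : (0 : ℝ) ≤ k), mul_nonneg (Nat.cast_nonneg k : (0 : ℝ) ≤ k) hR0.le]
    have h1 := Φ.translation_invariant {0} (isConvexBody_singleton' 0) x β hβ
    rw [← h1]
    have hm : MeasurableSet ((fun y => y + x) '' β) :=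
      (MeasurableEquiv.addRight x).measurableSet_image.2 hβ
    refine Φ.locality _ _ ({0, x}ᶜ) (isConvexBody_singleton' 0) ?_ ?_ ?_ _ hm ?_
    · rw [Set.image_singleton]; exact isConvexBody_singleton' _
    · exact ((Set.toFinite _).isClosed).isOpen_compl
    · ext z; simp
    · rintro _ ⟨b, hb, rfl⟩
      simp only [Set.mem_compl_iff, Set.mem_insert_iff, Set.mem_singleton_iff, not_or]
      constructor
      · intro h
        have : b = -x := eq_neg_of_add_eq_zero_left h
        have := hR b hb
        simp_all
        linarith
      · intro h
        have : b = 0 := by simpa using h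
        exact h0 (this ▸ hb)
  have hs := (Φ.meas {0}).m_iUnion (f := fun k : ℕ => (fun y => y + ((k : ℝ) + 1) • e) '' β)
    (fun k => (MeasurableEquiv.addRight (((k : ℝ) + 1) • e)).measurableSet_image.2 hβ) ?_
  · simp only [key] at hs
    exact const_hasSum_zero hs
  · intro j k hjk
    refine Set.disjoint_left.2 ?_
    rintro _ ⟨a, ha, rfl⟩ ⟨b, hb, hab⟩
    have h1 : a - b = ((k : ℝ) - j) • e := by
      simp only at hab
      have : a - b = ((k : ℝ) + 1) • e - ((j : ℝ) + 1) • e := by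
        rw [sub_eq_sub_iff_add_eq_add, ← hab]; abel
      rw [this, ← sub_smul]; congr 1; ring
    have h2 : ‖a - b‖ < 2 * R := by
      have := norm_sub_le a b
      linarith [hR a ha, hR b hb]
    rw [h1, norm_smul, he] at h2
    have h3 : (1 : ℝ) ≤ ‖(k : ℝ) - j‖ := by
      have : (1 : ℤ) ≤ |(k : ℤ) - j| := Int.one_le_abs (by omega)
      rw [Real.norm_eq_abs]
      exact_mod_cast this
    nlinarith

lemma meas_zero_off {n : ℕ} [NeZero n] (Φ : CurvatureMeasure n) (β : Set (Rn n))
    (hβ : MeasurableSet β) (h0 : (0 : Rn n) ∉ β) :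
    Φ.meas {0} β = 0 := by
  have hs := (Φ.meas {0}).m_iUnion (f := fun k : ℕ => β ∩ {x | ⌊‖x‖⌋₊ = k})
    (fun k => hβ.inter ((Nat.measurable_floor.comp measurable_norm) (measurableSet_singleton k))) ?_
  · have : (⋃ k : ℕ, β ∩ {x : Rn n | ⌊‖x‖⌋₊ = k}) = β := by ext; simp
    rw [this] at hs
    have hz : ∀ k : ℕ, Φ.meas {0} (β ∩ {x | ⌊‖x‖⌋₊ = k}) = 0 := fun k =>
      meas_zero_bounded Φ _
        (hβ.inter ((Nat.measurable_floor.comp measurable_norm) (measurableSet_singleton k)))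
        (k + 1) (by positivity)
        (by rintro x ⟨_, hx⟩; rw [← (show ⌊‖x‖⌋₊ = k from hx)]; exact Nat.lt_floor_add_one _)
        (fun h => h0 h.1)
    simp only [hz] at hs
    exact hs.unique hasSum_zero
  · intro j k hjk
    refine Set.disjoint_left.2 ?_
    rintro x ⟨_, h1⟩ ⟨_, h2⟩
    exact hjk (h1.symm.trans h2)

lemma meas_support {n : ℕ} [NeZero n] (Φ : CurvatureMeasure n) (K : Set (Rn n))
    (hK : IsConvexBody K) (β : Set (Rn n)) (hβ : MeasurableSet β) (hd : β ⊆ Kᶜ) :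
    Φ.meas K β = 0 := by
  obtain ⟨y, hy⟩ := hK.1
  have h1 : Φ.meas K β = Φ.meas {y} β := by
    refine Φ.locality _ _ Kᶜ hK (isConvexBody_singleton' y) hK.2.1.isClosed.isOpen_compl ?_ β hβ hd
    ext z; simp only [Set.mem_inter_iff, Set.mem_compl_iff, Set.mem_singleton_iff]
    constructor
    · rintro ⟨a, b⟩; exact absurd a b
    · rintro ⟨rfl, b⟩; exact absurd hy b
  have h2 := Φ.translation_invariant {y} (isConvexBody_singleton' y) (-y) β hβ
  rw [h1, ← h2, Set.image_singleton, add_neg_cancel]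
  refine meas_zero_off Φ _ ((MeasurableEquiv.addRight (-y)).measurableSet_image.2 hβ) ?_
  rintro ⟨b, hb, h⟩
  have : b = y := by simpa [add_neg_eq_zero] using h
  exact hd hb (this ▸ hy)

lemma jordan_null {α : Type*} [MeasurableSpace α] (s : SignedMeasure α) (A : Set α)
    (hA : MeasurableSet A) (h : ∀ β, MeasurableSet β → β ⊆ A → s β = 0) :
    s.toJordanDecomposition.posPart A = 0 ∧ s.toJordanDecomposition.negPart A = 0 := by
  obtain ⟨i, hi₁, hi₂, hi₃, hμ, hν⟩ := s.toJordanDecomposition_spec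
  rw [hμ, hν]
  constructor
  · rw [SignedMeasure.toMeasureOfZeroLE_apply _ _ _ hA]
    simp [h _ (hi₁.inter hA) Set.inter_subset_right]
  · rw [SignedMeasure.toMeasureOfLEZero_apply _ _ _ hA]
    simp [h _ (hi₁.compl.inter hA) Set.inter_subset_right]

lemma jordan_total {α : Type*} [MeasurableSpace α] (s : SignedMeasure α)
    (h : s Set.univ = 0) :
    s.toJordanDecomposition.posPart.real Set.univ =
      s.toJordanDecomposition.negPart.real Set.univ := by
  have h1 := s.toSignedMeasure_toJordanDecomposition
  have h2 : s.toJordanDecomposition.toSignedMeasure Set.univ = 0 := by rw [h1, h]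
  rw [JordanDecomposition.toSignedMeasure,
    Measure.toSignedMeasure_sub_apply MeasurableSet.univ] at h2
  linarith

lemma integral_functional {n : ℕ} (m : Measure (Rn n)) [IsFiniteMeasure m] (K : Set (Rn n))
    (hK : IsCompact K) (hm : m Kᶜ = 0) (f : (Fin n → ℂ) →ₗ[ℂ] ℂ) (c : ℂ)
    (hf : ∀ x ∈ K, f (fun i => ((x i : ℝ) : ℂ)) = c) :
    f (fun i => ∫ x, ((x i : ℝ) : ℂ) ∂m) = (m.real Set.univ : ℂ) * c := by
  have hae : ∀ᵐ x ∂m, x ∈ K := hm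
  have hint : ∀ i : Fin n, Integrable (fun x : Rn n => ((x i : ℝ) : ℂ)) m := by
    intro i
    obtain ⟨C, hC⟩ := hK.isBounded.exists_norm_le
    have hc : Continuous (fun x : Rn n => ((x i : ℝ) : ℂ)) := by fun_prop
    refine Integrable.of_bound hc.aestronglyMeasurable C ?_
    filter_upwards [hae] with x hx
    rw [Complex.norm_real]
    exact (PiLp.norm_apply_le x i).trans (hC x hx)
  have e : ∀ w : Fin n → ℂ, f w = ∑ i, w i * f (Pi.single i 1) := by
    intro w
    rw [LinearMap.pi_apply_eq_sum_univ f w]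
    refine Finset.sum_congr rfl fun i _ => ?_
    rw [smul_eq_mul]
    congr 2
    ext j
    simp [Pi.single_apply, eq_comm]
  calc f (fun i => ∫ x, ((x i : ℝ) : ℂ) ∂m)
      = ∫ x, f (fun i => ((x i : ℝ) : ℂ)) ∂m := by
        rw [e]
        simp_rw [fun x : Rn n => e (fun i => ((x i : ℝ) : ℂ))]
        rw [integral_finset_sum _ fun i _ => (hint i).mul_const _]
        simp only [integral_mul_const]
    _ = ∫ x, c ∂m := integral_congr_ae (hae.mono fun x hx => hf x hx)
    _ = _ := by simp

/-- For a translation invariant curvature measure globalizing to zero, the vector of coordinate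
integrals of Φ(K,·) lies in the complexification of the direction space of the affine hull
of K, i.e. in the complex span of the differences of points of K. -/
theorem coordinate_integrals_mem_direction_span (n : ℕ) (Φ : CurvatureMeasure n)
    (hglob : ∀ K : Set (Rn n), IsConvexBody K → Φ.meas K Set.univ = 0) :
    ∀ K : Set (Rn n), IsConvexBody K →
      (fun i : Fin n => cmIntegral (Φ.meas K) (fun x => ((x i : ℝ) : ℂ)))
        ∈ Submodule.span ℂ
          {v : Fin n → ℂ | ∃ y ∈ K, ∃ z ∈ K, v = fun i => (((y i - z i : ℝ)) : ℂ)} := by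
  intro K hK
  rcases Nat.eq_zero_or_pos n with rfl | hn
  · convert Submodule.zero_mem _
  haveI : NeZero n := ⟨hn.ne'⟩
  by_contra hv
  obtain ⟨f, hfv, hker⟩ := Submodule.exists_le_ker_of_notMem hv
  apply hfv
  obtain ⟨y, hy⟩ := hK.1
  have hf : ∀ x ∈ K, f (fun i => ((x i : ℝ) : ℂ)) = f (fun i => ((y i : ℝ) : ℂ)) := by
    intro x hx
    have := hker (Submodule.subset_span ⟨x, hx, y, hy, rfl⟩)
    rw [LinearMap.mem_ker] at this
    rw [← sub_eq_zero, ← map_sub, ← this]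
    congr 1
    ext i
    simp
  have hKm : MeasurableSet Kᶜ := hK.2.1.isClosed.measurableSet.compl
  have hre := jordan_null (ComplexMeasure.re (Φ.meas K)) Kᶜ hKm (fun β hβ hs => by
    simp [ComplexMeasure.re, VectorMeasure.mapRangeₗ, meas_support Φ K hK β hβ hs])
  have him := jordan_null (ComplexMeasure.im (Φ.meas K)) Kᶜ hKm (fun β hβ hs => by
    simp [ComplexMeasure.im, VectorMeasure.mapRangeₗ, meas_support Φ K hK β hβ hs])
  have hre0 := jordan_total (ComplexMeasure.re (Φ.meas K)) (by
    simp [ComplexMeasure.re, VectorMeasure.mapRangeₗ, hglob K hK])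
  have him0 := jordan_total (ComplexMeasure.im (Φ.meas K)) (by
    simp [ComplexMeasure.im, VectorMeasure.mapRangeₗ, hglob K hK])
  have h1 := integral_functional _ K hK.2.1 hre.1 f _ hf
  have h2 := integral_functional _ K hK.2.1 hre.2 f _ hf
  have h3 := integral_functional _ K hK.2.1 him.1 f _ hf
  have h4 := integral_functional _ K hK.2.1 him.2 f _ hf
  rw [← hre0, ← h1] at h2
  rw [← him0, ← h3] at h4
  have hsplit : (fun i : Fin n => cmIntegral (Φ.meas K) (fun x => ((x i : ℝ) : ℂ))) =
      ((fun i => ∫ x, ((x i : ℝ) : ℂ) ∂(ComplexMeasure.re (Φ.meas K)).toJordanDecomposition.posPart)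
      - (fun i => ∫ x, ((x i : ℝ) : ℂ) ∂(ComplexMeasure.re (Φ.meas K)).toJordanDecomposition.negPart))
      + Complex.I •
      ((fun i => ∫ x, ((x i : ℝ) : ℂ) ∂(ComplexMeasure.im (Φ.meas K)).toJordanDecomposition.posPart)
      - (fun i => ∫ x, ((x i : ℝ) : ℂ) ∂(ComplexMeasure.im (Φ.meas K)).toJordanDecomposition.negPart)) := by
    ext i
    simp [cmIntegral]
  rw [hsplit, map_add, map_smul, map_sub, map_sub, h2, h4]
  simp
end

section
/- Let Φ be a translation invariant curvature measure on ℝⁿ and let B ⊆ ℝⁿ be a bounded set. Then the supremum of the total variation norms ‖Φ(K,·)‖ over all convex bodies K with K ⊆ B is finite. -/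
open MeasureTheory Metric Filter Topology
open scoped Pointwise

lemma half_aux {X : Type*} [TopologicalSpace X] [MeasurableSpace X] [BorelSpace X]
    (p : Measure X) [IsFiniteMeasure p] (F : Set X) (hF : MeasurableSet F) (f : X → ℝ)
    (hf : Integrable f p) (h1 : ∀ x ∈ F, f x = 1) (h2 : ∀ x, -1 ≤ f x) :
    p.real Set.univ - 2 * p.real Fᶜ ≤ ∫ x, f x ∂p := by
  have : ∫ x, (1 - 2 * Fᶜ.indicator (fun _ => (1:ℝ)) x) ∂p = p.real Set.univ - 2 * p.real Fᶜ := by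
    rw [integral_sub (integrable_const _)
      (((integrable_const (1:ℝ)).indicator hF.compl).const_mul 2), integral_const_mul,
      integral_indicator hF.compl]
    simp
  rw [← this]
  apply integral_mono _ hf
  · intro x
    by_cases hx : x ∈ F
    · simp [hx, h1 x hx]
    · have := h2 x
      simp [hx]; linarith
  · exact (integrable_const _).sub (((integrable_const (1:ℝ)).indicator hF.compl).const_mul 2)

lemma tv_aux {n : ℕ} (p q : Measure (Rn n)) [IsFiniteMeasure p] [IsFiniteMeasure q]
    (hs : p ⟂ₘ q) (C : ℝ)
    (h : ∀ f : C(Rn n, ℝ), (∀ x, |f x| ≤ 1) → ∫ x, f x ∂p - ∫ x, f x ∂q ≤ C) :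
    p.real Set.univ + q.real Set.univ ≤ C := by
  obtain ⟨S, hS, hp, hq⟩ := hs
  apply le_of_forall_pos_le_add
  intro ε hε
  have hε' : ENNReal.ofReal (ε/4) ≠ 0 := by simp; linarith
  obtain ⟨F, hFS, hFc, hF⟩ := hS.compl.exists_isClosed_sdiff_lt (measure_ne_top p _) hε'
  obtain ⟨G, hGS, hGc, hG⟩ := hS.exists_isClosed_sdiff_lt (measure_ne_top q _) hε'
  have hd : Disjoint G F := by
    rw [Set.disjoint_left]
    intro x hx hx'
    exact hFS hx' (hGS hx)
  obtain ⟨g, g0, g1, g01⟩ := exists_continuous_zero_one_of_isClosed hGc hFc hd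
  let f : C(Rn n, ℝ) := 2 * g - 1
  have hfx : ∀ x, f x = 2 * g x - 1 := fun x => rfl
  have hb : ∀ x, |f x| ≤ 1 := by
    intro x
    have := g01 x
    rw [hfx, abs_le]
    constructor <;> linarith [this.1, this.2]
  have hi : ∀ (μ : Measure (Rn n)) [IsFiniteMeasure μ], Integrable (fun x => f x) μ := by
    intro μ _
    exact Integrable.of_bound f.continuous.aestronglyMeasurable 1 (ae_of_all _ hb)
  have e1 := half_aux p F hFc.measurableSet f (hi p)
    (fun x hx => by rw [hfx, g1 hx]; norm_num) (fun x => (abs_le.1 (hb x)).1)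
  have e2 := half_aux q G hGc.measurableSet (fun x => - f x) (hi q).neg
    (fun x hx => by rw [hfx, g0 hx]; norm_num) (fun x => by linarith [(abs_le.1 (hb x)).2])
  rw [integral_neg] at e2
  have m1 : p.real Fᶜ ≤ ε/4 := by
    apply ENNReal.toReal_le_of_le_ofReal (by linarith)
    calc p Fᶜ ≤ p (S ∪ (Sᶜ \ F)) := measure_mono (by intro x hx; by_cases x ∈ S <;> simp_all)
      _ ≤ p S + p (Sᶜ \ F) := measure_union_le _ _
      _ ≤ _ := by rw [hp, zero_add]; exact hF.le
  have m2 : q.real Gᶜ ≤ ε/4 := by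
    apply ENNReal.toReal_le_of_le_ofReal (by linarith)
    calc q Gᶜ ≤ q (Sᶜ ∪ (S \ G)) := measure_mono (by intro x hx; by_cases x ∈ S <;> simp_all)
      _ ≤ q Sᶜ + q (S \ G) := measure_union_le _ _
      _ ≤ _ := by rw [hq, zero_add]; exact hG.le
  have := h f hb
  linarith

lemma bcf_int {n : ℕ} (p : Measure (Rn n)) [IsFiniteMeasure p] :
    ∃ T : BoundedContinuousFunction (Rn n) ℂ →L[ℂ] ℂ, ∀ f, T f = ∫ x, f x ∂p := by
  refine ⟨LinearMap.mkContinuous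
    { toFun := fun f => ∫ x, f x ∂p
      map_add' := fun f g => integral_add (f.integrable p) (g.integrable p)
      map_smul' := fun c f => integral_smul c _ } (p.real Set.univ) ?_, fun f => rfl⟩
  intro f
  simpa using! f.norm_integral_le_mul_norm p

lemma cm_clm {n : ℕ} (μ : ComplexMeasure (Rn n)) :
    ∃ T : BoundedContinuousFunction (Rn n) ℂ →L[ℂ] ℂ, ∀ f, T f = cmIntegral μ f := by
  obtain ⟨T1, h1⟩ := bcf_int (ComplexMeasure.re μ).toJordanDecomposition.posPart
  obtain ⟨T2, h2⟩ := bcf_int (ComplexMeasure.re μ).toJordanDecomposition.negPart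
  obtain ⟨T3, h3⟩ := bcf_int (ComplexMeasure.im μ).toJordanDecomposition.posPart
  obtain ⟨T4, h4⟩ := bcf_int (ComplexMeasure.im μ).toJordanDecomposition.negPart
  refine ⟨(T1 - T2) + Complex.I • (T3 - T4), fun f => ?_⟩
  simp [cmIntegral, h1, h2, h3, h4]

lemma cm_var_le {n : ℕ} (μ : ComplexMeasure (Rn n)) (C : ℝ)
    (h : ∀ f : BoundedContinuousFunction (Rn n) ℂ, ‖f‖ ≤ 1 → ‖cmIntegral μ f‖ ≤ C) :
    cmVariation μ Set.univ ≤ ENNReal.ofReal (2 * C) := by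
  have key : ∀ f : C(Rn n, ℝ), (∀ x, |f x| ≤ 1) →
      ‖(((∫ x, f x ∂(ComplexMeasure.re μ).toJordanDecomposition.posPart)
        - (∫ x, f x ∂(ComplexMeasure.re μ).toJordanDecomposition.negPart) : ℝ) : ℂ)
      + Complex.I * (((∫ x, f x ∂(ComplexMeasure.im μ).toJordanDecomposition.posPart)
        - (∫ x, f x ∂(ComplexMeasure.im μ).toJordanDecomposition.negPart) : ℝ) : ℂ)‖ ≤ C := by
    intro f hf
    let F : BoundedContinuousFunction (Rn n) ℂ := BoundedContinuousFunction.ofNormedAddCommGroup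
      (fun x => (f x : ℂ)) (by fun_prop) 1 (by intro x; simpa using hf x)
    have := h F (BoundedContinuousFunction.norm_ofNormedAddCommGroup_le _ zero_le_one _)
    have hF : ∀ x, F x = (f x : ℂ) := fun x => rfl
    simp only [cmIntegral, hF, integral_complex_ofReal] at this
    push_cast
    exact this
  have r := tv_aux _ _ (ComplexMeasure.re μ).toJordanDecomposition.mutuallySingular C
    (fun f hf => by
      refine le_trans ?_ (key f hf)
      refine le_trans (le_of_eq ?_) (Complex.re_le_norm _)
      simp)
  have i := tv_aux _ _ (ComplexMeasure.im μ).toJordanDecomposition.mutuallySingular C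
    (fun f hf => by
      refine le_trans ?_ (key f hf)
      refine le_trans (le_of_eq ?_) ((le_abs_self _).trans (Complex.abs_im_le_norm _))
      simp)
  have : cmVariation μ Set.univ ≠ ⊤ := by
    simp [cmVariation, SignedMeasure.totalVariation]
  rw [← ENNReal.ofReal_toReal this]
  apply ENNReal.ofReal_le_ofReal
  simp only [cmVariation, SignedMeasure.totalVariation, Measure.add_apply]
  rw [ENNReal.toReal_add (by simp) (by simp), ENNReal.toReal_add (by simp) (by simp),
    ENNReal.toReal_add (by simp) (by simp)]
  simp only [Measure.real] at r i
  linarith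

open TopologicalSpace in
lemma blaschke {n : ℕ} (B : Set (Rn n)) (hB : Bornology.IsBounded B) (K : ℕ → Set (Rn n))
    (hK : ∀ i, IsConvexBody (K i)) (hKB : ∀ i, K i ⊆ B) :
    ∃ (L : Set (Rn n)) (φ : ℕ → ℕ), IsConvexBody L ∧ StrictMono φ ∧
      Tendsto (fun i => hausdorffDist (K (φ i)) L) atTop (𝓝 0) := by
  let k : ℕ → NonemptyCompacts (Rn n) := fun i => ⟨⟨K i, (hK i).2.1⟩, (hK i).1⟩
  obtain ⟨L, hL, φ, hφ, hlim⟩ := (NonemptyCompacts.isCompact_subsets_of_isCompact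
    hB.isCompact_closure).tendsto_subseq (x := k) (fun i => (hKB i).trans subset_closure)
  have hd : Tendsto (fun i => hausdorffDist (K (φ i)) L) atTop (𝓝 0) :=
    tendsto_iff_dist_tendsto_zero.1 hlim
  refine ⟨L, φ, ⟨L.nonempty, L.isCompact, ?_⟩, hφ, hd⟩
  have hfin : ∀ i, hausdorffEDist (K i) (L : Set (Rn n)) ≠ ⊤ := fun i =>
    hausdorffEDist_ne_top_of_nonempty_of_bounded (hK i).1 L.nonempty (hK i).2.1.isBounded
      L.isCompact.isBounded
  intro x hx y hy a b ha hb hab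
  rw [L.isCompact.isClosed.mem_iff_infDist_zero L.nonempty]
  apply le_antisymm _ infDist_nonneg
  apply le_of_forall_pos_le_add
  intro ε hε
  obtain ⟨i, hi⟩ := (hd.eventually (gt_mem_nhds (half_pos hε))).exists
  have hi' := hi
  rw [hausdorffDist_comm] at hi'
  obtain ⟨x', hx', dx⟩ := exists_dist_lt_of_hausdorffDist_lt hx hi'
    (by rw [hausdorffEDist_comm]; exact hfin _)
  obtain ⟨y', hy', dy⟩ := exists_dist_lt_of_hausdorffDist_lt hy hi'
    (by rw [hausdorffEDist_comm]; exact hfin _)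
  have hz := (hK (φ i)).2.2 hx' hy' ha hb hab
  obtain ⟨w, hw, dw⟩ := exists_dist_lt_of_hausdorffDist_lt hz hi (hfin _)
  have h3 : dist (a • x + b • y) (a • x' + b • y') ≤ ε / 2 := by
    calc _ ≤ dist (a • x) (a • x') + dist (b • y) (b • y') := dist_add_add_le _ _ _ _
      _ = a * dist x x' + b * dist y y' := by
        rw [dist_smul₀, dist_smul₀, Real.norm_of_nonneg ha, Real.norm_of_nonneg hb]
      _ ≤ a * (ε/2) + b * (ε/2) := by gcongr
      _ = ε / 2 := by rw [← add_mul, hab, one_mul]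
  have h4 := infDist_le_dist_of_mem (x := a • x + b • y) hw
  have h5 := dist_triangle (a • x + b • y) (a • x' + b • y') w
  linarith

/-- For a translation invariant curvature measure Φ and a bounded set B, the total variation
norms of Φ(K,·) are uniformly bounded over all convex bodies K contained in B. -/
theorem curvatureMeasure_uniformly_bounded_on_bounded (n : ℕ) (Φ : CurvatureMeasure n)
    (B : Set (Rn n)) (hB : Bornology.IsBounded B) :
    ∃ C : ℝ, ∀ K : Set (Rn n), IsConvexBody K → K ⊆ B →
      cmVariation (Φ.meas K) Set.univ ≤ ENNReal.ofReal C := by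
  by_contra! hcon
  choose K hK hKB hlt using fun i : ℕ => hcon i
  obtain ⟨L, φ, hL, hφ, hlim⟩ := blaschke B hB K hK hKB
  choose T hT using fun i => cm_clm (Φ.meas (K (φ i)))
  obtain ⟨C, hC⟩ := banach_steinhaus (g := T) (fun f => by
    have := Φ.continuity (fun i => K (φ i)) L (fun i => hK _) hL hlim f
    obtain ⟨c, hc⟩ := (this.norm).bddAbove_range
    refine ⟨c, fun i => ?_⟩
    rw [hT]
    exact hc ⟨i, rfl⟩)
  obtain ⟨i, hi⟩ := exists_nat_ge (2 * C)
  have h1 := cm_var_le (Φ.meas (K (φ i))) C (fun f hf => by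
    rw [← hT]
    refine ((T i).le_of_opNorm_le (hC i) f).trans ?_
    have : 0 ≤ C := (norm_nonneg _).trans (hC i)
    nlinarith)
  have h2 : (2 * C) ≤ ((φ i : ℕ) : ℝ) := hi.trans (by exact_mod_cast hφ.id_le i)
  exact absurd (hlt (φ i)) (not_lt.2 (h1.trans (ENNReal.ofReal_le_ofReal h2)))
end

section
/- Let Φ be a translation invariant curvature measure on ℝⁿ and suppose there exists r > 0 such that Φ(K, β) = 0 for every Borel set β and every convex body K contained in the closed ball of radius r centered at the origin. Then Φ(K, β) = 0 for every convex body K and every Borel set β. -/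
open MeasureTheory Metric Filter Topology
open scoped Pointwise

/-- A translation invariant curvature measure that vanishes on all convex bodies contained in
some closed ball of positive radius vanishes identically. -/
theorem curvatureMeasure_eq_zero_of_vanishes_on_small_bodies (n : ℕ) (Φ : CurvatureMeasure n)
    (r : ℝ) (hr : 0 < r)
    (h : ∀ K : Set (Rn n), IsConvexBody K → K ⊆ Metric.closedBall (0 : Rn n) r →
      ∀ β : Set (Rn n), MeasurableSet β → Φ.meas K β = 0) :
    ∀ K : Set (Rn n), IsConvexBody K → ∀ β : Set (Rn n), MeasurableSet β →
      Φ.meas K β = 0 := by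
  have small : ∀ (x : Rn n) (L : Set (Rn n)), IsConvexBody L → L ⊆ closedBall x r →
      ∀ β : Set (Rn n), MeasurableSet β → Φ.meas L β = 0 := by
    intro x L hL hLx β hβ
    rw [← Φ.translation_invariant L hL (-x) β hβ]
    refine h _ ⟨hL.1.image _, hL.2.1.image (by fun_prop), ?_⟩ ?_ _ ?_
    · have := hL.2.2.translate (-x)
      simpa [add_comm] using this
    · rintro _ ⟨y, hy, rfl⟩
      have := hLx hy
      simpa [dist_eq_norm, sub_eq_add_neg] using this
    · exact (Homeomorph.addRight (-x)).measurableEmbedding.measurableSet_image.2 hβ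
  intro K hK
  have split : ∀ U : Set (Rn n), MeasurableSet U → ∀ β, MeasurableSet β →
      Φ.meas K β = Φ.meas K (β ∩ U) + Φ.meas K (β \ U) := by
    intro U hU β hβ
    rw [← VectorMeasure.of_union (Set.disjoint_sdiff_right.mono_left Set.inter_subset_right)
      (hβ.inter hU) (hβ.diff hU), Set.inter_union_diff]
  have key : ∃ U : Set (Rn n), IsOpen U ∧ K ⊆ U ∧
      ∀ β, MeasurableSet β → β ⊆ U → Φ.meas K β = 0 := by
    refine hK.2.1.induction_on (p := fun s => ∃ U : Set (Rn n), IsOpen U ∧ s ⊆ U ∧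
      ∀ β, MeasurableSet β → β ⊆ U → Φ.meas K β = 0) ?_ ?_ ?_ ?_
    · refine ⟨∅, isOpen_empty, le_rfl, fun β _ hb => ?_⟩
      rw [Set.subset_empty_iff.1 hb, VectorMeasure.empty]
    · rintro s t hst ⟨U, hU, htU, H⟩
      exact ⟨U, hU, hst.trans htU, H⟩
    · rintro s t ⟨U, hU, hsU, H⟩ ⟨V, hV, htV, H'⟩
      refine ⟨U ∪ V, hU.union hV, Set.union_subset_union hsU htV, fun β hβ hb => ?_⟩
      rw [split U hU.measurableSet β hβ, H _ (hβ.inter hU.measurableSet) Set.inter_subset_right,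
        H' _ (hβ.diff hU.measurableSet) (Set.diff_subset_iff.2 hb), add_zero]
    · intro x hx
      refine ⟨ball x r, mem_nhdsWithin_of_mem_nhds (ball_mem_nhds x hr), ball x r, isOpen_ball,
        le_rfl, fun β hβ hb => ?_⟩
      have hL : IsConvexBody (K ∩ closedBall x r) :=
        ⟨⟨x, hx, mem_closedBall_self hr.le⟩, hK.2.1.inter_right isClosed_closedBall,
          hK.2.2.inter (convex_closedBall x r)⟩
      rw [Φ.locality K (K ∩ closedBall x r) (ball x r) hK hL isOpen_ball ?_ β hβ hb]
      · exact small x _ hL Set.inter_subset_right β hβ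
      · rw [Set.inter_assoc, Set.inter_eq_self_of_subset_right ball_subset_closedBall]
  obtain ⟨U, hU, hKU, H⟩ := key
  intro β hβ
  rw [split U hU.measurableSet β hβ, H _ (hβ.inter hU.measurableSet) Set.inter_subset_right,
    zero_add]
  obtain ⟨x, hx⟩ := hK.1
  have hL : IsConvexBody ({x} : Set (Rn n)) :=
    ⟨Set.singleton_nonempty x, isCompact_singleton, convex_singleton x⟩
  rw [Φ.locality K {x} Kᶜ hK hL hK.2.1.isClosed.isOpen_compl ?_ _ (hβ.diff hU.measurableSet)
    (fun y hy hyK => hy.2 (hKU hyK))]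
  · exact small x _ hL (by simpa using hr.le) _ (hβ.diff hU.measurableSet)
  · ext y
    simp only [Set.mem_inter_iff, Set.mem_compl_iff, Set.mem_singleton_iff]
    constructor
    · rintro ⟨a, b⟩
      exact absurd a b
    · rintro ⟨rfl, b⟩
      exact absurd hx b
end

section
/- Let B ⊆ ℝⁿ be a bounded set containing the origin in its interior, and for a translation invariant curvature measure Φ set ‖Φ‖_B = sup { ‖Φ(K,·)‖ : K a convex body with K ⊆ B }, where ‖·‖ is the total variation norm. If (Φ_s) is a sequence of translation invariant curvature measures on ℝⁿ that is Cauchy with respect to ‖·‖_B, then there exists a translation invariant curvature measure Φ on ℝⁿ with ‖Φ_s − Φ‖_B → 0 as s → ∞. -/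
open MeasureTheory Metric Filter Topology
open scoped Pointwise

namespace CMC

variable {n : ℕ}

lemma signed_le (s : SignedMeasure (Rn n)) (β : Set (Rn n)) (hβ : MeasurableSet β) :
    |s β| ≤ s.totalVariation.real Set.univ := by
  rw [s.apply_eq_posPart_real_sub_negPart_real hβ]
  have e : s.totalVariation.real Set.univ = s.toJordanDecomposition.posPart.real Set.univ
      + s.toJordanDecomposition.negPart.real Set.univ := by
    rw [SignedMeasure.totalVariation, measureReal_add_apply]
  have h1 := measureReal_mono (μ := s.toJordanDecomposition.posPart) (Set.subset_univ β)
  have h2 := measureReal_mono (μ := s.toJordanDecomposition.negPart) (Set.subset_univ β)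
  have h3 := measureReal_nonneg (μ := s.toJordanDecomposition.posPart) (s := β)
  have h4 := measureReal_nonneg (μ := s.toJordanDecomposition.negPart) (s := β)
  rw [abs_le]; constructor <;> linarith

lemma signed_tv (s : SignedMeasure (Rn n)) (c : ℝ) (h : ∀ β, MeasurableSet β → |s β| ≤ c) :
    s.totalVariation.real Set.univ ≤ 2 * c := by
  have e : s.totalVariation.real Set.univ = s.toJordanDecomposition.posPart.real Set.univ
      + s.toJordanDecomposition.negPart.real Set.univ := by
    rw [SignedMeasure.totalVariation, measureReal_add_apply]
  obtain ⟨i, hi, h1, h2, h3, h4⟩ := s.toJordanDecomposition_spec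
  rw [e, h3, h4, SignedMeasure.toMeasureOfZeroLE_real_apply _ _ _ MeasurableSet.univ,
    SignedMeasure.toMeasureOfLEZero_real_apply _ _ _ MeasurableSet.univ]
  simp only [Set.inter_univ]
  have := abs_le.1 (h i hi)
  have := abs_le.1 (h iᶜ hi.compl)
  linarith

instance tvfin (s : SignedMeasure (Rn n)) : IsFiniteMeasure s.totalVariation := by
  unfold SignedMeasure.totalVariation; infer_instance

instance cvfin (μ : ComplexMeasure (Rn n)) : IsFiniteMeasure (cmVariation μ) := by
  unfold cmVariation; infer_instance

lemma cv_real (μ : ComplexMeasure (Rn n)) : (cmVariation μ).real Set.univ =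
    (ComplexMeasure.re μ).totalVariation.real Set.univ +
    (ComplexMeasure.im μ).totalVariation.real Set.univ := by
  rw [cmVariation, measureReal_add_apply]

lemma norm_le_of_cv (μ : ComplexMeasure (Rn n)) (c : ℝ) (hc : 0 ≤ c)
    (h : cmVariation μ Set.univ ≤ ENNReal.ofReal c) (β : Set (Rn n)) (hβ : MeasurableSet β) :
    ‖μ β‖ ≤ c := by
  have h' : (cmVariation μ).real Set.univ ≤ c := ENNReal.toReal_le_of_le_ofReal hc h
  rw [cv_real] at h'
  have h1 : |(μ β).re| ≤ _ := signed_le (ComplexMeasure.re μ) β hβ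
  have h2 : |(μ β).im| ≤ _ := signed_le (ComplexMeasure.im μ) β hβ
  have := Complex.norm_le_abs_re_add_abs_im (μ β)
  linarith

lemma cv_le_of_norm (μ : ComplexMeasure (Rn n)) (c : ℝ) (h : ∀ β, MeasurableSet β → ‖μ β‖ ≤ c) :
    (cmVariation μ).real Set.univ ≤ 4 * c := by
  rw [cv_real]
  have h1 := signed_tv (ComplexMeasure.re μ) c
    fun β hβ => (Complex.abs_re_le_norm (μ β)).trans (h β hβ)
  have h2 := signed_tv (ComplexMeasure.im μ) c
    fun β hβ => (Complex.abs_im_le_norm (μ β)).trans (h β hβ)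
  linarith

lemma cv_le_of_norm' (μ : ComplexMeasure (Rn n)) (c : ℝ) (h : ∀ β, MeasurableSet β → ‖μ β‖ ≤ c) :
    cmVariation μ Set.univ ≤ ENNReal.ofReal (4 * c) := by
  rw [← ENNReal.ofReal_toReal (measure_ne_top (cmVariation μ) Set.univ)]
  exact ENNReal.ofReal_le_ofReal (cv_le_of_norm μ c h)

noncomputable def sInt (s : SignedMeasure (Rn n)) (f : Rn n → ℂ) : ℂ :=
  (∫ x, f x ∂s.toJordanDecomposition.posPart) - (∫ x, f x ∂s.toJordanDecomposition.negPart)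

lemma sInt_sub (s t : SignedMeasure (Rn n)) (f : BoundedContinuousFunction (Rn n) ℂ) :
    sInt s f - sInt t f = sInt (s - t) f := by
  have key : s.toJordanDecomposition.posPart + (t.toJordanDecomposition.negPart +
      (s-t).toJordanDecomposition.negPart) = s.toJordanDecomposition.negPart +
      (t.toJordanDecomposition.posPart + (s-t).toJordanDecomposition.posPart) := by
    rw [← Measure.toSignedMeasure_eq_toSignedMeasure_iff]
    ext β hβ
    have h1 := s.apply_eq_posPart_real_sub_negPart_real hβ
    have h2 := t.apply_eq_posPart_real_sub_negPart_real hβ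
    have h3 := (s-t).apply_eq_posPart_real_sub_negPart_real hβ
    rw [_root_.sub_apply] at h3
    rw [Measure.toSignedMeasure_apply_measurable hβ, Measure.toSignedMeasure_apply_measurable hβ,
      measureReal_add_apply, measureReal_add_apply, measureReal_add_apply, measureReal_add_apply]
    linarith
  have hi : ∀ μ : Measure (Rn n), IsFiniteMeasure μ → Integrable f μ :=
    fun μ _ => f.integrable μ
  have k2 := congrArg (fun μ : Measure (Rn n) => ∫ x, f x ∂μ) key
  rw [integral_add_measure (hi _ inferInstance) (hi _ inferInstance),
    integral_add_measure (hi _ inferInstance) (hi _ inferInstance),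
    integral_add_measure (hi _ inferInstance) (hi _ inferInstance),
    integral_add_measure (hi _ inferInstance) (hi _ inferInstance)] at k2
  unfold sInt
  linear_combination k2

lemma sInt_norm (s : SignedMeasure (Rn n)) (f : BoundedContinuousFunction (Rn n) ℂ) :
    ‖sInt s f‖ ≤ ‖f‖ * s.totalVariation.real Set.univ := by
  have e : s.totalVariation.real Set.univ = s.toJordanDecomposition.posPart.real Set.univ
      + s.toJordanDecomposition.negPart.real Set.univ := by
    rw [SignedMeasure.totalVariation, measureReal_add_apply]
  rw [e, mul_add]
  refine (norm_sub_le _ _).trans (add_le_add ?_ ?_)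
  · exact norm_integral_le_of_norm_le_const (ae_of_all _ f.norm_coe_le_norm)
  · exact norm_integral_le_of_norm_le_const (ae_of_all _ f.norm_coe_le_norm)

lemma cmIntegral_sub_le (μ ν : ComplexMeasure (Rn n)) (f : BoundedContinuousFunction (Rn n) ℂ) :
    ‖cmIntegral μ f - cmIntegral ν f‖ ≤ ‖f‖ * (cmVariation (μ - ν)).real Set.univ := by
  have e : cmIntegral μ f - cmIntegral ν f = sInt (ComplexMeasure.re (μ - ν)) f +
      Complex.I * sInt (ComplexMeasure.im (μ - ν)) f := by
    rw [map_sub, map_sub, ← sInt_sub, ← sInt_sub]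
    unfold sInt cmIntegral
    ring
  rw [e, cv_real, mul_add]
  refine (norm_add_le _ _).trans (add_le_add (sInt_norm _ f) ?_)
  rw [norm_mul, Complex.norm_I, one_mul]
  exact sInt_norm _ f

lemma cm_biUnion (μ : ComplexMeasure (Rn n)) {ι : Type} (F : Finset ι) (f : ι → Set (Rn n))
    (hf : ∀ i, MeasurableSet (f i)) (hd : Pairwise (Function.onFun Disjoint f)) :
    μ (⋃ i ∈ F, f i) = ∑ i ∈ F, μ (f i) := by
  classical
  induction F using Finset.induction_on with
  | empty => simp
  | insert a F ha ih =>
    rw [Finset.set_biUnion_insert, VectorMeasure.of_union, Finset.sum_insert ha, ih]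
    · simp only [Set.disjoint_iUnion_right]
      intro i hi
      exact hd (fun h => ha (h ▸ hi))
    · exact hf a
    · exact Finset.measurableSet_biUnion _ fun i _ => hf i

/-- uniform limits of complex measures -/
lemma exists_limit (μ : ℕ → ComplexMeasure (Rn n))
    (h : ∀ ε : ℝ, 0 < ε → ∃ N : ℕ, ∀ s t, N ≤ s → N ≤ t → ∀ β, MeasurableSet β →
      ‖(μ s - μ t) β‖ ≤ ε) :
    ∃ ν : ComplexMeasure (Rn n), ∀ β, MeasurableSet β →
      Tendsto (fun s => μ s β) atTop (𝓝 (ν β)) := by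
  have hc : ∀ β, ∃ l, Tendsto (fun s => μ s β) atTop (𝓝 l) := by
    intro β
    by_cases hβ : MeasurableSet β
    · apply cauchySeq_tendsto_of_complete
      rw [Metric.cauchySeq_iff']
      intro ε hε
      obtain ⟨N, hN⟩ := h (ε/2) (by linarith)
      refine ⟨N, fun s hs => ?_⟩
      have := hN s N hs le_rfl β hβ
      rw [_root_.sub_apply] at this
      rw [dist_eq_norm]; linarith
    · exact ⟨0, by simp [VectorMeasure.not_measurable _ hβ]⟩
  choose l hl using hc
  refine ⟨⟨l, ?_, ?_, ?_⟩, fun β _ => hl β⟩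
  · exact tendsto_nhds_unique (hl ∅) (by simp)
  · intro β hβ
    exact tendsto_nhds_unique (hl β) (by simp [VectorMeasure.not_measurable _ hβ])
  · intro f hf hd
    rw [HasSum, SummationFilter.unconditional_filter, Metric.tendsto_nhds]
    intro ε hε
    obtain ⟨N, hN⟩ := h (ε/4) (by linarith)
    have h1 := (μ N).m_iUnion hf hd
    rw [HasSum, SummationFilter.unconditional_filter, Metric.tendsto_nhds] at h1
    filter_upwards [h1 (ε/4) (by linarith)] with F hF
    have a1 : ‖(∑ i ∈ F, l (f i)) - ∑ i ∈ F, μ N (f i)‖ ≤ ε/4 := by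
      refine le_of_tendsto ((tendsto_finsetSum F fun i _ => hl (f i)).sub_const _).norm ?_
      filter_upwards [eventually_ge_atTop N] with s hs
      rw [← cm_biUnion _ _ _ hf hd, ← cm_biUnion _ _ _ hf hd, ← _root_.sub_apply]
      exact hN s N hs le_rfl _ (Finset.measurableSet_biUnion _ fun i _ => hf i)
    have a2 : ‖l (⋃ i, f i) - μ N (⋃ i, f i)‖ ≤ ε/4 := by
      refine le_of_tendsto ((hl _).sub_const _).norm ?_
      filter_upwards [eventually_ge_atTop N] with s hs
      rw [← _root_.sub_apply]
      exact hN s N hs le_rfl _ (MeasurableSet.iUnion hf)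
    rw [← dist_eq_norm] at a1 a2
    have := dist_triangle4_right (∑ i ∈ F, l (f i)) (l (⋃ i, f i)) (∑ i ∈ F, μ N (f i)) (μ N (⋃ i, f i))
    linarith

lemma singleton_body (p : Rn n) : IsConvexBody ({p} : Set (Rn n)) :=
  ⟨Set.singleton_nonempty p, isCompact_singleton, convex_singleton p⟩

lemma translate_body {K : Set (Rn n)} (hK : IsConvexBody K) (x : Rn n) :
    IsConvexBody ((fun y => y + x) '' K) := by
  refine ⟨hK.1.image _, hK.2.1.image (by fun_prop), ?_⟩
  have := hK.2.2.translate x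
  simpa [add_comm] using this

lemma translate_meas {β : Set (Rn n)} (hβ : MeasurableSet β) (x : Rn n) :
    MeasurableSet ((fun y => y + x) '' β) :=
  (MeasurableEquiv.addRight x).measurableSet_image.2 hβ

section
variable (Φ Ψ : CurvatureMeasure n) (ε r : ℝ) (hr : 0 < r)
  (h : ∀ K : Set (Rn n), IsConvexBody K → K ⊆ closedBall 0 r → ∀ β, MeasurableSet β →
    ‖(Φ.meas K - Ψ.meas K) β‖ ≤ ε)
include h

lemma bound_translate {K : Set (Rn n)} (hK : IsConvexBody K) (x : Rn n)
    (hKx : K ⊆ closedBall x r) {β : Set (Rn n)} (hβ : MeasurableSet β) :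
    ‖(Φ.meas K - Ψ.meas K) β‖ ≤ ε := by
  have := h ((fun y => y + -x) '' K) (translate_body hK (-x)) ?_ ((fun y => y + -x) '' β)
    (translate_meas hβ _)
  · rw [_root_.sub_apply, Φ.translation_invariant K hK _ β hβ,
      Ψ.translation_invariant K hK _ β hβ, ← _root_.sub_apply] at this
    exact this
  · rintro _ ⟨y, hy, rfl⟩
    have := hKx hy
    rw [mem_closedBall, dist_eq_norm] at this
    simpa [sub_eq_add_neg] using this

include hr

lemma bound_compl {K : Set (Rn n)} (hK : IsConvexBody K)
    {β : Set (Rn n)} (hβ : MeasurableSet β) (hs : β ⊆ Kᶜ) :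
    ‖(Φ.meas K - Ψ.meas K) β‖ ≤ ε := by
  obtain ⟨p, hp⟩ := hK.1
  have hU : IsOpen Kᶜ := hK.2.1.isClosed.isOpen_compl
  have e : K ∩ Kᶜ = {p} ∩ Kᶜ := by
    ext y; simp only [Set.mem_inter_iff, Set.mem_compl_iff, Set.mem_singleton_iff]
    constructor
    · rintro ⟨a, b⟩; exact absurd a b
    · rintro ⟨rfl, b⟩; exact absurd hp b
  have := bound_translate Φ Ψ ε r h (singleton_body p) p (by simpa using hr.le) hβ
  rw [_root_.sub_apply, Φ.locality K {p} Kᶜ hK (singleton_body p) hU e β hβ hs,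
    Ψ.locality K {p} Kᶜ hK (singleton_body p) hU e β hβ hs, ← _root_.sub_apply]
  exact this

lemma bound_ball {K : Set (Rn n)} (hK : IsConvexBody K) (x : Rn n)
    {β : Set (Rn n)} (hβ : MeasurableSet β) (hs : β ⊆ ball x r) :
    ‖(Φ.meas K - Ψ.meas K) β‖ ≤ ε := by
  by_cases hne : (K ∩ closedBall x r).Nonempty
  · have hK' : IsConvexBody (K ∩ closedBall x r) :=
      ⟨hne, hK.2.1.inter_right isClosed_closedBall, hK.2.2.inter (convex_closedBall x r)⟩
    have e : K ∩ ball x r = (K ∩ closedBall x r) ∩ ball x r := by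
      rw [Set.inter_assoc, Set.inter_eq_right.2 ball_subset_closedBall]
    have := bound_translate Φ Ψ ε r h hK' x Set.inter_subset_right hβ
    rw [_root_.sub_apply, Φ.locality K _ _ hK hK' isOpen_ball e β hβ hs,
      Ψ.locality K _ _ hK hK' isOpen_ball e β hβ hs, ← _root_.sub_apply]
    exact this
  · refine bound_compl Φ Ψ ε r hr h hK hβ fun y hy hyK => hne ⟨y, hyK, ball_subset_closedBall (hs hy)⟩

lemma bound_union {K : Set (Rn n)} (hK : IsConvexBody K) (T : Finset (Rn n)) :
    ∀ {β : Set (Rn n)}, MeasurableSet β → β ⊆ Kᶜ ∪ ⋃ x ∈ T, ball x r →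
    ‖(Φ.meas K - Ψ.meas K) β‖ ≤ (T.card + 1) * ε := by
  classical
  induction T using Finset.induction_on with
  | empty =>
    intro β hβ hs
    simpa using bound_compl Φ Ψ ε r hr h hK hβ (by simpa using hs)
  | insert a T ha ih =>
    intro β hβ hs
    rw [← Set.inter_union_sdiff β (ball a r), VectorMeasure.of_union
      (Set.disjoint_sdiff_right.mono_left Set.inter_subset_right)
      (hβ.inter measurableSet_ball) (hβ.diff measurableSet_ball), Finset.card_insert_of_notMem ha]
    have h1 := bound_ball Φ Ψ ε r hr h hK a (hβ.inter measurableSet_ball) Set.inter_subset_right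
    have h2 := ih (hβ.diff (measurableSet_ball (x := a) (ε := r))) (by
      rintro y ⟨hy, hy'⟩
      have := hs hy
      rw [Finset.set_biUnion_insert] at this
      rcases this with h | h | h
      · exact Or.inl h
      · exact absurd h hy'
      · exact Or.inr h)
    refine (norm_add_le _ _).trans ?_
    rw [Nat.cast_add, Nat.cast_one]
    linarith

end

theorem main (n : ℕ) (B : Set (Rn n)) (h0 : (0 : Rn n) ∈ interior B)
    (Φs : ℕ → CurvatureMeasure n)
    (hcauchy : ∀ ε : ℝ, 0 < ε → ∃ N : ℕ, ∀ s t : ℕ, N ≤ s → N ≤ t →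
      ∀ K : Set (Rn n), IsConvexBody K → K ⊆ B →
        cmVariation ((Φs s).meas K - (Φs t).meas K) Set.univ ≤ ENNReal.ofReal ε) :
    ∃ Φ : CurvatureMeasure n, ∀ ε : ℝ, 0 < ε → ∃ N : ℕ, ∀ s : ℕ, N ≤ s →
      ∀ K : Set (Rn n), IsConvexBody K → K ⊆ B →
        cmVariation ((Φs s).meas K - Φ.meas K) Set.univ ≤ ENNReal.ofReal ε := by
  classical
  have hc1 : ∀ ε : ℝ, 0 < ε → ∃ N : ℕ, ∀ s t : ℕ, N ≤ s → N ≤ t →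
      ∀ K : Set (Rn n), IsConvexBody K → K ⊆ B → ∀ β, MeasurableSet β →
        ‖((Φs s).meas K - (Φs t).meas K) β‖ ≤ ε := by
    intro ε hε
    obtain ⟨N, hN⟩ := hcauchy ε hε
    exact ⟨N, fun s t hs ht K hK hKB => norm_le_of_cv _ ε hε.le (hN s t hs ht K hK hKB)⟩
  obtain ⟨r, hr, hrB⟩ := Metric.nhds_basis_closedBall.mem_iff.1 (mem_interior_iff_mem_nhds.1 h0)
  have hc2 : ∀ R ε : ℝ, 0 < ε → ∃ N : ℕ, ∀ s t : ℕ, N ≤ s → N ≤ t →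
      ∀ K : Set (Rn n), IsConvexBody K → K ⊆ closedBall 0 R → ∀ β, MeasurableSet β →
        ‖((Φs s).meas K - (Φs t).meas K) β‖ ≤ ε := by
    intro R ε hε
    obtain ⟨T, -, hT⟩ := (isCompact_closedBall (0 : Rn n) R).elim_nhds_subcover
      (fun x => ball x r) (fun x _ => ball_mem_nhds x hr)
    have hpos : (0:ℝ) < T.card + 1 := by positivity
    obtain ⟨N, hN⟩ := hc1 (ε / (T.card + 1)) (by positivity)
    refine ⟨N, fun s t hs ht K hK hKR β hβ => ?_⟩
    have := bound_union (Φs s) (Φs t) (ε / (T.card + 1)) r hr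
      (fun K hK hKr => hN s t hs ht K hK (hKr.trans hrB)) hK T hβ (by
        intro y _
        by_cases hy : y ∈ K
        · exact Or.inr (hT (hKR hy))
        · exact Or.inl hy)
    rwa [mul_div_cancel₀ _ hpos.ne'] at this
  have hlim : ∀ K : Set (Rn n), ∃ ν : ComplexMeasure (Rn n), IsConvexBody K →
      ∀ β, MeasurableSet β → Tendsto (fun s => (Φs s).meas K β) atTop (𝓝 (ν β)) := by
    intro K
    by_cases hK : IsConvexBody K
    · obtain ⟨R, hR⟩ := hK.2.1.isBounded.subset_closedBall 0
      obtain ⟨ν, hν⟩ := exists_limit (fun s => (Φs s).meas K) (fun ε hε => by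
        obtain ⟨N, hN⟩ := hc2 R ε hε
        exact ⟨N, fun s t hs ht => hN s t hs ht K hK hR⟩)
      exact ⟨ν, fun _ => hν⟩
    · exact ⟨0, fun h => absurd h hK⟩
  choose ν hν using hlim
  have hpass : ∀ (K : Set (Rn n)) (hK : IsConvexBody K) (ε : ℝ) (N : ℕ),
      (∀ s t : ℕ, N ≤ s → N ≤ t → ∀ β, MeasurableSet β →
        ‖((Φs s).meas K - (Φs t).meas K) β‖ ≤ ε) →
      ∀ s, N ≤ s → ∀ β, MeasurableSet β → ‖((Φs s).meas K - ν K) β‖ ≤ ε := by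
    intro K hK ε N hN s hs β hβ
    rw [_root_.sub_apply]
    refine le_of_tendsto ((hν K hK β hβ).const_sub _).norm ?_
    filter_upwards [eventually_ge_atTop N] with t ht
    rw [← _root_.sub_apply]
    exact hN s t hs ht β hβ
  refine ⟨⟨ν, ?_, ?_, ?_⟩, ?_⟩
  · intro K L U hK hL hU e β hβ hs
    refine tendsto_nhds_unique (hν K hK β hβ) ?_
    simp_rw [fun s => (Φs s).locality K L U hK hL hU e β hβ hs]
    exact hν L hL β hβ
  · intro K hK x β hβ
    refine tendsto_nhds_unique (hν _ (translate_body hK x) _ (translate_meas hβ x)) ?_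
    simp_rw [fun s => (Φs s).translation_invariant K hK x β hβ]
    exact hν K hK β hβ
  · intro Ki K hKi hK hd f
    obtain ⟨R, hR⟩ := (hK.2.1.isBounded.cthickening (δ := 1)).subset_closedBall (0 : Rn n)
    have hKR : K ⊆ closedBall 0 R := (self_subset_cthickening K).trans hR
    have hKiR : ∀ᶠ i in atTop, Ki i ⊆ closedBall 0 R := by
      filter_upwards [hd.eventually_lt_const (zero_lt_one)] with i hi
      refine Set.Subset.trans (fun x hx => ?_) hR
      obtain ⟨y, hy, hxy⟩ := exists_dist_lt_of_hausdorffDist_lt hx hi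
        (hausdorffEDist_ne_top_of_nonempty_of_bounded (hKi i).1 hK.1
          (hKi i).2.1.isBounded hK.2.1.isBounded)
      exact mem_cthickening_of_dist_le x y 1 K hy hxy.le
    rw [Metric.tendsto_nhds]
    intro ε hε
    have hpos : 0 < ‖f‖ + 1 := by positivity
    set η := ε / (16 * (‖f‖ + 1)) with hη
    have hη0 : 0 < η := by positivity
    obtain ⟨N, hN⟩ := hc2 R η hη0
    have key : ∀ L, IsConvexBody L → L ⊆ closedBall 0 R →
        ‖cmIntegral ((Φs N).meas L) f - cmIntegral (ν L) f‖ ≤ ε / 4 := by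
      intro L hL hLR
      refine (cmIntegral_sub_le _ _ f).trans ?_
      have h4 := cv_le_of_norm _ η
        (hpass L hL η N (fun s t hs ht => hN s t hs ht L hL hLR) N le_rfl)
      calc _ ≤ (‖f‖ + 1) * (4 * η) := by gcongr; linarith
        _ = ε / 4 := by rw [hη]; field_simp; norm_num
    have hcont := Metric.tendsto_nhds.1 ((Φs N).continuity Ki K hKi hK hd f) (ε/4) (by linarith)
    filter_upwards [hKiR, hcont] with i hi hi'
    have a1 := key _ (hKi i) hi
    have a2 := key K hK hKR
    rw [← dist_eq_norm] at a1 a2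
    rw [dist_comm] at a1
    have := dist_triangle4 (cmIntegral (ν (Ki i)) f) (cmIntegral ((Φs N).meas (Ki i)) f)
      (cmIntegral ((Φs N).meas K) f) (cmIntegral (ν K) f)
    linarith
  · intro ε hε
    obtain ⟨N, hN⟩ := hc1 (ε/4) (by linarith)
    refine ⟨N, fun s hs K hK hKB => ?_⟩
    have := cv_le_of_norm' _ (ε/4)
      (hpass K hK (ε/4) N (fun s t hs ht => hN s t hs ht K hK hKB) s hs)
    rwa [mul_div_cancel₀ _ (by norm_num : (4:ℝ) ≠ 0)] at this

end CMC

/-- Completeness of the norm ‖Φ‖_B = sup {‖Φ(K,·)‖ : K convex body, K ⊆ B} on translation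
invariant curvature measures: every Cauchy sequence converges in this norm. -/
theorem curvatureMeasure_norm_complete (n : ℕ) (B : Set (Rn n))
    (hB : Bornology.IsBounded B) (h0 : (0 : Rn n) ∈ interior B)
    (Φs : ℕ → CurvatureMeasure n)
    (hcauchy : ∀ ε : ℝ, 0 < ε → ∃ N : ℕ, ∀ s t : ℕ, N ≤ s → N ≤ t →
      ∀ K : Set (Rn n), IsConvexBody K → K ⊆ B →
        cmVariation ((Φs s).meas K - (Φs t).meas K) Set.univ ≤ ENNReal.ofReal ε) :
    ∃ Φ : CurvatureMeasure n, ∀ ε : ℝ, 0 < ε → ∃ N : ℕ, ∀ s : ℕ, N ≤ s →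
      ∀ K : Set (Rn n), IsConvexBody K → K ⊆ B →
        cmVariation ((Φs s).meas K - Φ.meas K) Set.univ ≤ ENNReal.ofReal ε := by
  exact CMC.main n B h0 Φs hcauchy
end

section
/- Let n ≥ 2 and let f : ℝⁿ∖{0} → ℂ be a smooth function homogeneous of degree −n. Then for every invertible linear map g ∈ GL(n,ℝ), ∫_{S^{n−1}} f(g u) dσ(u) = |det g|⁻¹ ∫_{S^{n−1}} f(u) dσ(u), where σ denotes the spherical surface measure on the unit sphere S^{n−1}. -/
open MeasureTheory Metric Filter Topology

lemma inner_radial (n : ℕ) (hn : 2 ≤ n) (c : ℂ) (a : ℝ) (ha : 0 < a) :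
    ∫ r : Set.Ioi (0 : ℝ), (if r.1 * a ∈ Set.Icc (1:ℝ) 2 then
      ((r.1 ^ (-(n : ℤ)) : ℝ) : ℂ) * c else 0) ∂(Measure.volumeIoiPow (n - 1))
      = (Real.log 2 : ℂ) * c := by
  simp only [Measure.volumeIoiPow, ENNReal.ofReal]
  rw [integral_withDensity_eq_integral_smul
    ((measurable_subtype_coe.pow_const _).real_toNNReal)]
  rw [integral_subtype_comap measurableSet_Ioi (fun r : ℝ ↦ Real.toNNReal (r ^ (n - 1)) •
    (if r * a ∈ Set.Icc (1:ℝ) 2 then ((r ^ (-(n : ℤ)) : ℝ) : ℂ) * c else 0))]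
  have h1 : ∀ r ∈ Set.Ioi (0:ℝ), Real.toNNReal (r ^ (n - 1)) •
      (if r * a ∈ Set.Icc (1:ℝ) 2 then ((r ^ (-(n : ℤ)) : ℝ) : ℂ) * c else 0)
      = (Set.Icc (1 / a) (2 / a)).indicator (fun r : ℝ => ((r⁻¹ : ℝ) : ℂ) * c) r := by
    intro r hr
    have hr' : 0 < r := hr
    rw [NNReal.smul_def, Real.coe_toNNReal _ (pow_nonneg hr'.le _)]
    have hiff : r ∈ Set.Icc (1 / a) (2 / a) ↔ r * a ∈ Set.Icc (1:ℝ) 2 := by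
      simp only [Set.mem_Icc, div_le_iff₀ ha, le_div_iff₀ ha]
    by_cases h : r * a ∈ Set.Icc (1:ℝ) 2
    · rw [Set.indicator_of_mem (hiff.2 h), if_pos h, Complex.real_smul, ← mul_assoc,
        ← Complex.ofReal_mul]
      congr 2
      obtain ⟨m, rfl⟩ : ∃ m, n = m + 1 := ⟨n - 1, by omega⟩
      rw [zpow_neg, zpow_natCast, Nat.add_sub_cancel, pow_succ]
      field_simp
    · rw [Set.indicator_of_notMem (fun h' => h (hiff.1 h')), if_neg h, smul_zero]
  rw [setIntegral_congr_fun measurableSet_Ioi h1, setIntegral_indicator measurableSet_Icc]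
  have h2 : Set.Ioi (0:ℝ) ∩ Set.Icc (1 / a) (2 / a) = Set.Icc (1 / a) (2 / a) := by
    apply Set.inter_eq_right.2
    intro x hx
    exact lt_of_lt_of_le (by positivity) hx.1
  have hle : 1 / a ≤ 2 / a := by gcongr; norm_num
  rw [h2, integral_Icc_eq_integral_Ioc, integral_mul_const, integral_complex_ofReal,
    ← intervalIntegral.integral_of_le hle, integral_inv_of_pos (by positivity) (by positivity)]
  congr 3
  field_simp

lemma polar_aux (n : ℕ) (hn : 2 ≤ n) (f : Rn n → ℂ)
    (hc : ContinuousOn f {(0 : Rn n)}ᶜ)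
    (hhom : ∀ t : ℝ, 0 < t → ∀ x : Rn n, x ≠ 0 →
      f (t • x) = ((t ^ (-(n : ℤ)) : ℝ) : ℂ) * f x)
    (A : Rn n ≃L[ℝ] Rn n) :
    ∫ x in {x : Rn n | ‖A x‖ ∈ Set.Icc (1:ℝ) 2}, f x
      = (Real.log 2 : ℂ) * ∫ u : Metric.sphere (0 : Rn n) 1, f u
        ∂((volume : Measure (Rn n)).toSphere) := by
  set K : Set (Rn n) := {x : Rn n | ‖A x‖ ∈ Set.Icc (1:ℝ) 2} with hK
  have hKcl : IsClosed K := isClosed_Icc.preimage (A.continuous.norm)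
  have hKc : IsCompact K := by
    have : IsCompact (A ⁻¹' (Metric.closedBall (0 : Rn n) 2)) :=
      A.toHomeomorph.isCompact_preimage.2 (isCompact_closedBall _ _)
    refine this.of_isClosed_subset hKcl ?_
    intro x hx
    simpa using hx.2
  have hK0 : K ⊆ {(0 : Rn n)}ᶜ := by
    rintro x hx rfl
    have := hx.1
    simp at this
    linarith
  have hint : Integrable (K.indicator f) volume :=
    (integrable_indicator_iff hKcl.measurableSet).2 ((hc.mono hK0).integrableOn_compact hKc)
  have hdim : Module.finrank ℝ (Rn n) = n := by simp
  have hmp := (volume : Measure (Rn n)).measurePreserving_homeomorphUnitSphereProd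
  rw [hdim] at hmp
  set G : Metric.sphere (0 : Rn n) 1 × Set.Ioi (0:ℝ) → ℂ :=
    fun p => K.indicator f (p.2.1 • p.1.1) with hG
  have hcomp : ∀ x : ({(0 : Rn n)}ᶜ : Set (Rn n)),
      G (homeomorphUnitSphereProd (Rn n) x) = K.indicator f x.1 := by
    intro x
    have := congrArg Subtype.val ((homeomorphUnitSphereProd (Rn n)).symm_apply_apply x)
    rw [homeomorphUnitSphereProd_symm_apply_coe] at this
    simp only [hG]
    rw [this]
  have hGint : Integrable G ((volume : Measure (Rn n)).toSphere.prod
      (Measure.volumeIoiPow (n - 1))) := by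
    rw [← hmp.integrable_comp_emb (Homeomorph.measurableEmbedding _)]
    have : G ∘ (homeomorphUnitSphereProd (Rn n)) = K.indicator f ∘ Subtype.val :=
      funext hcomp
    rw [this, ← integrableOn_iff_comap_subtypeVal (measurableSet_singleton _).compl]
    exact hint.integrableOn
  have : Nontrivial (Rn n) := Module.nontrivial_of_finrank_pos (R := ℝ) (by rw [hdim]; omega)
  calc ∫ x in K, f x = ∫ x, K.indicator f x := (integral_indicator hKcl.measurableSet).symm
    _ = ∫ x : ({(0 : Rn n)}ᶜ : Set (Rn n)), K.indicator f x.1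
          ∂((volume : Measure (Rn n)).comap (↑)) := by
      rw [integral_subtype_comap (measurableSet_singleton _).compl (fun x ↦ K.indicator f x),
        restrict_compl_singleton]
    _ = ∫ p, G p ∂((volume : Measure (Rn n)).toSphere.prod (Measure.volumeIoiPow (n - 1))) := by
      rw [← hmp.integral_comp (Homeomorph.measurableEmbedding _)]
      exact integral_congr_ae (.of_forall fun x => (hcomp x).symm)
    _ = ∫ u, ∫ r, G (u, r) ∂(Measure.volumeIoiPow (n - 1))
          ∂((volume : Measure (Rn n)).toSphere) := integral_prod _ hGint
    _ = ∫ u : Metric.sphere (0 : Rn n) 1, (Real.log 2 : ℂ) * f u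
          ∂((volume : Measure (Rn n)).toSphere) := by
      refine integral_congr_ae (.of_forall fun u => ?_)
      have hu : u.1 ≠ 0 := ne_zero_of_mem_unit_sphere u
      have hA : 0 < ‖A u.1‖ := norm_pos_iff.2 (by simpa using hu)
      beta_reduce
      rw [← inner_radial n hn (f u) _ hA]
      refine integral_congr_ae (.of_forall fun r => ?_)
      have hr : 0 < r.1 := r.2
      simp only [hG, Set.indicator, hK, Set.mem_setOf_eq, map_smul, norm_smul, Real.norm_eq_abs,
        abs_of_pos hr, hhom r.1 hr u.1 hu]
    _ = _ := integral_const_mul _ _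

/-- For a smooth function f on ℝⁿ∖{0} homogeneous of degree −n and an invertible linear map g,
the spherical integral of f ∘ g equals |det g|⁻¹ times the spherical integral of f. -/
theorem sphere_integral_homogeneous_transform (n : ℕ) (hn : 2 ≤ n) (f : Rn n → ℂ)
    (hsm : ContDiffOn ℝ (⊤ : ℕ∞) f {(0 : Rn n)}ᶜ)
    (hhom : ∀ t : ℝ, 0 < t → ∀ x : Rn n, x ≠ 0 →
      f (t • x) = ((t ^ (-(n : ℤ)) : ℝ) : ℂ) * f x)
    (g : Rn n ≃ₗ[ℝ] Rn n) :
    ∫ u : Metric.sphere (0 : Rn n) 1, f (g u) ∂((volume : Measure (Rn n)).toSphere)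
      = ((|LinearMap.det (g : Rn n →ₗ[ℝ] Rn n)|⁻¹ : ℝ) : ℂ)
        * ∫ u : Metric.sphere (0 : Rn n) 1, f u ∂((volume : Measure (Rn n)).toSphere) := by
  have hc : ContinuousOn f {(0 : Rn n)}ᶜ := hsm.continuousOn
  have hc' : ContinuousOn (fun x => f (g x)) {(0 : Rn n)}ᶜ := by
    refine hc.comp (g.toContinuousLinearEquiv.continuous.continuousOn) ?_
    intro x hx
    simpa using hx
  have h1 := polar_aux n hn (fun x => f (g x)) hc' (by
    intro t ht x hx
    rw [map_smul]
    exact hhom t ht (g x) (by simpa using hx)) (ContinuousLinearEquiv.refl ℝ _)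
  have h2 := polar_aux n hn f hc hhom g.symm.toContinuousLinearEquiv
  have hdet : LinearMap.det (g : Rn n →ₗ[ℝ] Rn n) ≠ 0 := g.isUnit_det'.ne_zero
  have hmap := Measure.map_linearMap_addHaar_eq_smul_addHaar (volume : Measure (Rn n)) hdet
  set K : Set (Rn n) := {x : Rn n | ‖g.symm x‖ ∈ Set.Icc (1:ℝ) 2} with hK
  have hKm : MeasurableSet K :=
    (isClosed_Icc.preimage (g.symm.toContinuousLinearEquiv.continuous.norm)).measurableSet
  have h3 : ∫ x in {x : Rn n | ‖x‖ ∈ Set.Icc (1:ℝ) 2}, f (g x)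
      = ((|LinearMap.det (g : Rn n →ₗ[ℝ] Rn n)|⁻¹ : ℝ) : ℂ) * ∫ x in K, f x := by
    have he : MeasurableEmbedding (g : Rn n → Rn n) :=
      g.toContinuousLinearEquiv.toHomeomorph.measurableEmbedding
    have := he.setIntegral_map (μ := volume) f K
    have hpre : (g : Rn n → Rn n) ⁻¹' K = {x : Rn n | ‖x‖ ∈ Set.Icc (1:ℝ) 2} := by
      ext x; simp [hK]
    rw [hpre] at this
    rw [← this]
    have hmap' : Measure.map (g : Rn n → Rn n) volume = ENNReal.ofReal
      |(LinearMap.det (g : Rn n →ₗ[ℝ] Rn n))⁻¹| • (volume : Measure (Rn n)) := hmap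
    rw [hmap', Measure.restrict_smul, integral_smul_measure,
      ENNReal.toReal_ofReal (abs_nonneg _), abs_inv, Complex.real_smul]
  have hlog : (Real.log 2 : ℂ) ≠ 0 := by
    exact_mod_cast (Real.log_pos (by norm_num)).ne'
  apply mul_left_cancel₀ hlog
  rw [← h1]
  refine h3.trans ?_
  rw [mul_left_comm, ← h2]
  rfl
end

section
/- Let n ≥ 2 and let φ : ℝⁿ∖{0} → ℂ be a smooth function homogeneous of degree −(n−1). Then for every x ∈ ℝⁿ, ∫_{S^{n−1}} ⟨∇φ(u), x⟩ dσ(u) = 0; equivalently, for each j ∈ {1,…,n}, the integral of the partial derivative ∂φ/∂x_j over the unit sphere S^{n−1} with respect to the spherical surface measure σ vanishes. -/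
open MeasureTheory Metric Filter Topology

lemma aux_polar (n : ℕ) (hn : 2 ≤ n) (ψ : ℝ → ℝ) (g : Rn n → ℂ) (k : ℤ)
    (hg : ∀ t : ℝ, 0 < t → ∀ x : Rn n, x ≠ 0 → g (t • x) = (t ^ k : ℝ) • g x) :
    ∫ y : Rn n, ψ (‖y‖ ^ 2) • g y =
      (∫ r in Set.Ioi (0 : ℝ), r ^ (n - 1) * (ψ (r ^ 2) * r ^ k)) •
        ∫ u : Metric.sphere (0 : Rn n) 1, g u ∂((volume : Measure (Rn n)).toSphere) := by
  have hdim : Module.finrank ℝ (Rn n) = n := by simp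
  calc
    ∫ y : Rn n, ψ (‖y‖ ^ 2) • g y
      = ∫ y : ({(0 : Rn n)}ᶜ : Set (Rn n)), ψ (‖y.1‖ ^ 2) • g y.1
          ∂((volume : Measure (Rn n)).comap (↑)) := by
      have : Nontrivial (Rn n) := by
        apply Module.nontrivial_of_finrank_pos (R := ℝ); rw [hdim]; omega
      rw [integral_subtype_comap (measurableSet_singleton _).compl
        fun y : Rn n ↦ ψ (‖y‖ ^ 2) • g y, restrict_compl_singleton]
    _ = ∫ z : Metric.sphere (0 : Rn n) 1 × Set.Ioi (0 : ℝ),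
          (ψ (z.2.1 ^ 2) * z.2.1 ^ k) • g z.1
          ∂((volume : Measure (Rn n)).toSphere.prod (.volumeIoiPow (n - 1))) := by
      have h := (volume : Measure (Rn n)).measurePreserving_homeomorphUnitSphereProd.integral_comp
        (Homeomorph.measurableEmbedding _)
        (fun z : Metric.sphere (0 : Rn n) 1 × Set.Ioi (0 : ℝ) =>
          (ψ (z.2.1 ^ 2) * z.2.1 ^ k) • g z.1)
      rw [hdim] at h
      rw [← h]
      congr 1
      ext y
      have hy : (y : Rn n) ≠ 0 := y.2
      have hy' : 0 < ‖(y : Rn n)‖ := norm_pos_iff.2 hy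
      simp only [homeomorphUnitSphereProd_apply_snd_coe, homeomorphUnitSphereProd_apply_fst_coe]
      rw [mul_smul, ← hg _ hy' _ (smul_ne_zero (inv_ne_zero hy'.ne') hy), smul_inv_smul₀ hy'.ne']
    _ = (∫ r : Set.Ioi (0 : ℝ), (ψ (r.1 ^ 2) * r.1 ^ k) ∂(.volumeIoiPow (n - 1))) •
        ∫ u : Metric.sphere (0 : Rn n) 1, g u ∂((volume : Measure (Rn n)).toSphere) := by
      rw [← integral_prod_swap]
      exact integral_prod_smul (fun r : Set.Ioi (0 : ℝ) => ψ (r.1 ^ 2) * r.1 ^ k)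
        (fun u : Metric.sphere (0 : Rn n) 1 => g u)
    _ = _ := by
      congr 1
      simp only [Measure.volumeIoiPow, ENNReal.ofReal]
      rw [integral_withDensity_eq_integral_smul,
        integral_subtype_comap measurableSet_Ioi
          fun a : ℝ ↦ Real.toNNReal (a ^ (n - 1)) • (ψ (a ^ 2) * a ^ k),
        setIntegral_congr_fun measurableSet_Ioi fun x hx ↦ ?_]
      · simp only [NNReal.smul_def, Real.coe_toNNReal _ (pow_nonneg (le_of_lt hx) _), smul_eq_mul]
      · exact (measurable_subtype_coe.pow_const _).real_toNNReal

lemma aux_integrable (n : ℕ) (ψ : ℝ → ℝ) (hψ : Continuous ψ)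
    (h0 : ∀ t, t ∉ Set.Icc (1 : ℝ) 3 → ψ t = 0) (g : Rn n → ℂ)
    (hg : ContinuousOn g {(0 : Rn n)}ᶜ) :
    Integrable (fun y : Rn n => ψ (‖y‖ ^ 2) • g y) := by
  set K : Set (Rn n) := {y | ‖y‖ ^ 2 ∈ Set.Icc (1 : ℝ) 3} with hK
  have hKc : IsCompact K := by
    apply Metric.isCompact_of_isClosed_isBounded
    · exact isClosed_Icc.preimage (by fun_prop)
    · apply (Metric.isBounded_closedBall (x := (0 : Rn n)) (r := 2)).subset
      intro y hy
      simp only [mem_closedBall, dist_zero_right]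
      have := hy.2
      nlinarith [norm_nonneg y]
  rw [← integrableOn_iff_integrable_of_support_subset (s := K)]
  · apply ContinuousOn.integrableOn_compact hKc
    apply ContinuousOn.fun_smul
    · exact (hψ.comp (by fun_prop : Continuous fun y : Rn n => ‖y‖ ^ 2)).continuousOn
    · apply hg.mono
      rintro y hy rfl
      have := hy.1
      norm_num at this
  · intro y hy
    by_contra hyK
    exact hy (by simp [h0 _ hyK])

lemma aux_hom (n : ℕ) (φ : Rn n → ℂ)
    (hhom : ∀ t : ℝ, 0 < t → ∀ x : Rn n, x ≠ 0 →
      φ (t • x) = ((t ^ (-((n : ℤ) - 1)) : ℝ) : ℂ) * φ x) (v : Rn n)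
    (t : ℝ) (ht : 0 < t) (x : Rn n) (hx : x ≠ 0) :
    fderiv ℝ φ (t • x) v = (t ^ (-(n : ℤ)) : ℝ) • fderiv ℝ φ x v := by
  have h1 : fderiv ℝ (fun y => φ (t • y)) x = t • fderiv ℝ φ (t • x) := by
    exact fderiv_comp_smul t
  have h2 : (fun y => φ (t • y)) =ᶠ[𝓝 x] fun y => (t ^ (-((n : ℤ) - 1)) : ℝ) • φ y := by
    filter_upwards [isOpen_compl_singleton.mem_nhds hx] with y hy
    rw [hhom t ht y hy]; simp
  have h3 := h2.fderiv_eq (𝕜 := ℝ)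
  rw [h1, show fderiv ℝ (fun y => (t ^ (-((n : ℤ) - 1)) : ℝ) • φ y) x =
    (t ^ (-((n : ℤ) - 1)) : ℝ) • fderiv ℝ φ x from
    congrFun (fderiv_const_smul_field (f := φ) (t ^ (-((n : ℤ) - 1)) : ℝ)) x] at h3
  have h4 := congrArg (fun L => t⁻¹ • L v) h3
  simp only [ContinuousLinearMap.smul_apply, Pi.smul_apply] at h4
  rw [inv_smul_smul₀ ht.ne', smul_smul] at h4
  rw [h4]
  congr 1
  rw [neg_sub, sub_eq_add_neg, zpow_add₀ ht.ne']
  simp [ht.ne']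

/-- For a smooth function φ on ℝⁿ∖{0} homogeneous of degree −(n−1), the spherical integral of
the directional derivative ⟨∇φ(u), x⟩ vanishes for every x ∈ ℝⁿ; in particular each partial
derivative of φ integrates to zero over the unit sphere. -/
theorem sphere_integral_gradient_eq_zero (n : ℕ) (hn : 2 ≤ n) (φ : Rn n → ℂ)
    (hsm : ContDiffOn ℝ (⊤ : ℕ∞) φ {(0 : Rn n)}ᶜ)
    (hhom : ∀ t : ℝ, 0 < t → ∀ x : Rn n, x ≠ 0 →
      φ (t • x) = ((t ^ (-((n : ℤ) - 1)) : ℝ) : ℂ) * φ x) :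
    ∀ x : Rn n,
      ∫ u : Metric.sphere (0 : Rn n) 1, (fderiv ℝ φ u) x
        ∂((volume : Measure (Rn n)).toSphere) = 0 := by
  intro v
  let η : ContDiffBump (2 : ℝ) := ⟨1 / 2, 1, by norm_num, by norm_num⟩
  have hηs : ContDiff ℝ 1 (η : ℝ → ℝ) := η.contDiff
  have hηt : tsupport (η : ℝ → ℝ) = Set.Icc 1 3 := by
    rw [η.tsupport_eq, Real.closedBall_eq_Icc]; norm_num [η]
  have hη0 : ∀ t, t ∉ Set.Icc (1 : ℝ) 3 → η t = 0 := by
    intro t ht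
    rw [← hηt] at ht
    exact image_eq_zero_of_notMem_tsupport ht
  have hη'0 : ∀ t, t ∉ Set.Icc (1 : ℝ) 3 → deriv η t = 0 := by
    intro t ht
    rw [← hηt] at ht
    by_contra h
    exact ht (support_deriv_subset h)
  have hη'c : Continuous (deriv η) := hηs.continuous_deriv le_rfl
  have hopen : IsOpen ({(0 : Rn n)}ᶜ : Set (Rn n)) := isOpen_compl_singleton
  have hφd : ∀ y : Rn n, y ≠ 0 → DifferentiableAt ℝ φ y := fun y hy =>
    (hsm.differentiableOn (by simp)).differentiableAt (hopen.mem_nhds hy)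
  have hφ'c : ContinuousOn (fun y => fderiv ℝ φ y v) ({(0 : Rn n)}ᶜ) :=
    (hsm.continuousOn_fderiv_of_isOpen hopen (by simp)).clm_apply continuousOn_const
  let f : Rn n → ℝ := fun y => η (‖y‖ ^ 2)
  have hfd : ∀ y, HasFDerivAt f (deriv η (‖y‖ ^ 2) • (2 • innerSL ℝ y)) y := by
    intro y
    exact ((hηs.differentiable one_ne_zero _).hasDerivAt).comp_hasFDerivAt y
      (hasStrictFDerivAt_norm_sq y).hasFDerivAt
  have hfv : ∀ y, fderiv ℝ f y v = deriv η (‖y‖ ^ 2) * (2 * inner ℝ y v) := by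
    intro y
    rw [(hfd y).fderiv]
    simp
  have hft : tsupport f ⊆ {(0 : Rn n)}ᶜ := by
    have : tsupport f ⊆ {y | ‖y‖ ^ 2 ∈ Set.Icc (1 : ℝ) 3} := by
      apply closure_minimal
      · intro y hy
        by_contra h
        exact hy (hη0 _ h)
      · exact isClosed_Icc.preimage (by fun_prop)
    rintro y hy rfl
    have := (this hy).1
    norm_num at this
  let g : Rn n → ℂ := fun y => (2 * inner ℝ y v : ℝ) • φ y
  have hgc : ContinuousOn g ({(0 : Rn n)}ᶜ) := by
    apply ContinuousOn.fun_smul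
    · fun_prop
    · exact hsm.continuousOn
  have hfg : ∀ y, fderiv ℝ f y v • φ y = deriv η (‖y‖ ^ 2) • g y := by
    intro y
    rw [hfv, mul_smul]
  have key := integral_smul_fderiv_eq_neg_fderiv_smul_of_integrable (μ := (volume : Measure (Rn n)))
    (f := f) (g := φ) (v := v)
    (by simp only [hfg]; exact aux_integrable n _ hη'c hη'0 g hgc)
    (aux_integrable n _ hηs.continuous hη0 _ hφ'c)
    (aux_integrable n _ hηs.continuous hη0 _ hsm.continuousOn)
    (fun y _ => (hfd y).differentiableAt)
    (fun y hy => hφd y (hft hy))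
  simp only [hfg] at key
  have hghom : ∀ t : ℝ, 0 < t → ∀ x : Rn n, x ≠ 0 →
      g (t • x) = (t ^ (2 - (n : ℤ)) : ℝ) • g x := by
    intro t ht x hx
    have : t ^ (2 - (n : ℤ)) = t * t ^ (-((n : ℤ) - 1)) := by
      rw [← zpow_one_add₀ ht.ne']; congr 1; ring
    simp only [g, hhom t ht x hx, inner_smul_left, this, Complex.real_smul]
    push_cast
    simp
    ring
  rw [aux_polar n hn _ g _ hghom, aux_polar n hn _ _ _ (aux_hom n φ hhom v)] at key
  have hI1 : ∫ r in Set.Ioi (0 : ℝ), r ^ (n - 1) * (deriv η (r ^ 2) * r ^ (2 - (n : ℤ))) = 0 := by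
    have hd : ∀ r : ℝ, HasDerivAt (fun r : ℝ => η (r ^ 2) / 2) (deriv η (r ^ 2) * r) r := by
      intro r
      have := (((hηs.differentiable one_ne_zero _).hasDerivAt).comp r
        (hasDerivAt_pow 2 r)).div_const 2
      refine HasDerivAt.congr_deriv (f := fun r : ℝ => η (r ^ 2) / 2) this ?_
      push_cast
      ring
    have hsup : HasCompactSupport (fun r : ℝ => η (r ^ 2) / 2) := by
      apply HasCompactSupport.intro (isCompact_Icc (a := (-2 : ℝ)) (b := 2))
      intro r hr
      rw [hη0, zero_div]
      intro h
      exact hr ⟨by nlinarith [h.2], by nlinarith [h.2]⟩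
    have := HasCompactSupport.integral_Ioi_deriv_eq (f := fun r : ℝ => η (r ^ 2) / 2)
      ((hηs.comp (contDiff_id.pow 2)).div_const 2) hsup 0
    rw [show -(η ((0 : ℝ) ^ 2) / 2) = 0 by
      have : η (0 : ℝ) = 0 := hη0 0 (by norm_num)
      simp [this]] at this
    refine Eq.trans ?_ this
    apply setIntegral_congr_fun measurableSet_Ioi
    intro r hr
    have hr : (0 : ℝ) < r := hr
    simp only
    refine Eq.trans ?_ (hd r).deriv.symm
    have : r ^ (n - 1) * r ^ (2 - (n : ℤ)) = r := by
      rw [← zpow_natCast, ← zpow_add₀ hr.ne', Nat.cast_sub (by omega)]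
      ring_nf
      simp
    linear_combination deriv η (r ^ 2) * this
  have hI2 : 0 < ∫ r in Set.Ioi (0 : ℝ), r ^ (n - 1) * (η (r ^ 2) * r ^ (-(n : ℤ))) := by
    have hsupp : Function.support (fun r : ℝ => η (r ^ 2) * r⁻¹) ∩ Set.Ioi 0 ⊆ Set.Icc 1 2 := by
      rintro r ⟨hr, hr0 : 0 < r⟩
      have h : r ^ 2 ∈ Set.Icc (1 : ℝ) 3 := by
        by_contra h
        exact hr (by simp [hη0 _ h])
      exact ⟨by nlinarith [h.1], by nlinarith [h.2]⟩
    have hint : IntegrableOn (fun r : ℝ => η (r ^ 2) * r⁻¹) (Set.Ioi 0) := by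
      have h1 : IntegrableOn (fun r : ℝ => η (r ^ 2) * r⁻¹) (Set.Icc 1 2) := by
        apply ContinuousOn.integrableOn_compact isCompact_Icc
        apply ContinuousOn.mul
        · exact (hηs.continuous.comp (continuous_pow 2)).continuousOn
        · apply ContinuousOn.inv₀ continuousOn_id
          intro r hr
          have := hr.1
          simp only [id]
          linarith
      apply h1.of_forall_sdiff_eq_zero measurableSet_Ioi
      intro r hr
      by_contra h
      exact hr.2 (hsupp ⟨h, hr.1⟩)
    have hpos : 0 < ∫ r in Set.Ioi (0 : ℝ), η (r ^ 2) * r⁻¹ := by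
      rw [setIntegral_pos_iff_support_of_nonneg_ae _ hint]
      · have hs : Set.Ioo (1.3 : ℝ) 1.5 ⊆
            Function.support (fun r : ℝ => η (r ^ 2) * r⁻¹) ∩ Set.Ioi 0 := by
          intro r hr
          have hr0 : (0 : ℝ) < r := by linarith [hr.1]
          refine ⟨?_, hr0⟩
          apply ne_of_gt
          apply mul_pos _ (inv_pos.2 hr0)
          apply η.pos_of_mem_ball
          rw [Real.ball_eq_Ioo]
          change r ^ 2 ∈ Set.Ioo (2 - 1 : ℝ) (2 + 1)
          exact ⟨by nlinarith [hr.1], by nlinarith [hr.2]⟩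
        refine lt_of_lt_of_le ?_ (measure_mono hs)
        rw [Real.volume_Ioo]
        norm_num
      · filter_upwards [ae_restrict_mem measurableSet_Ioi] with r hr
        exact mul_nonneg η.nonneg (inv_nonneg.2 (le_of_lt hr))
    refine lt_of_lt_of_eq hpos ?_
    apply setIntegral_congr_fun measurableSet_Ioi
    intro r hr
    have hr : (0 : ℝ) < r := hr
    simp only
    have : r ^ (n - 1) * r ^ (-(n : ℤ)) = r⁻¹ := by
      rw [← zpow_natCast, ← zpow_add₀ hr.ne', Nat.cast_sub (by omega), ← zpow_neg_one]
      congr 1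
      push_cast
      ring
    linear_combination -η (r ^ 2) * this
  rw [hI1, zero_smul, neg_zero] at key
  exact (smul_eq_zero.1 key).resolve_left hI2.ne'
end

section
/- Every translation invariant curvature measure Φ on ℝⁿ can be written uniquely as Φ = Φ₀ + Φ₁ + ⋯ + Φₙ (sums taken setwise on measures), where each Φᵢ is a translation invariant curvature measure homogeneous of degree i. Uniqueness means: if Φ₀ + ⋯ + Φₙ = Ψ₀ + ⋯ + Ψₙ with Φᵢ and Ψᵢ translation invariant curvature measures homogeneous of degree i, then Φᵢ = Ψᵢ for every i. -/
open MeasureTheory Metric Filter Topology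
open scoped Pointwise

section A
variable {n : ℕ}

noncomputable def sigInt (s : SignedMeasure (Rn n)) (f : Rn n → ℂ) : ℂ :=
  (∫ x, f x ∂s.toJordanDecomposition.posPart) - ∫ x, f x ∂s.toJordanDecomposition.negPart

lemma cmIntegral_eq (μ : ComplexMeasure (Rn n)) (f : Rn n → ℂ) :
    cmIntegral μ f = sigInt (ComplexMeasure.re μ) f + Complex.I * sigInt (ComplexMeasure.im μ) f :=
  rfl

lemma bcf_integrable (f : BoundedContinuousFunction (Rn n) ℂ) (μ : Measure (Rn n))
    [IsFiniteMeasure μ] : Integrable (fun x => f x) μ := f.integrable μ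

lemma sig_eq (s : SignedMeasure (Rn n)) :
    s = s.toJordanDecomposition.posPart.toSignedMeasure
      - s.toJordanDecomposition.negPart.toSignedMeasure :=
  s.toSignedMeasure_toJordanDecomposition.symm

lemma sigInt_of_eq (s : SignedMeasure (Rn n)) (p q : Measure (Rn n)) [IsFiniteMeasure p]
    [IsFiniteMeasure q] (h : s = p.toSignedMeasure - q.toSignedMeasure)
    (f : BoundedContinuousFunction (Rn n) ℂ) :
    sigInt s f = (∫ x, f x ∂p) - ∫ x, f x ∂q := by
  have h2 := sig_eq s
  have h3 : s.toJordanDecomposition.posPart + q = p + s.toJordanDecomposition.negPart := by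
    rw [← Measure.toSignedMeasure_eq_toSignedMeasure_iff, Measure.toSignedMeasure_add,
      Measure.toSignedMeasure_add]
    rw [h2] at h
    rw [sub_eq_sub_iff_add_eq_add] at h
    exact h
  have h4 := congrArg (fun m : Measure (Rn n) => ∫ x, f x ∂m) h3
  rw [integral_add_measure (bcf_integrable f _) (bcf_integrable f _),
    integral_add_measure (bcf_integrable f _) (bcf_integrable f _)] at h4
  unfold sigInt
  linear_combination h4

lemma sigInt_add (s t : SignedMeasure (Rn n)) (f : BoundedContinuousFunction (Rn n) ℂ) :
    sigInt (s + t) f = sigInt s f + sigInt t f := by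
  rw [sigInt_of_eq (s + t) (s.toJordanDecomposition.posPart + t.toJordanDecomposition.posPart)
    (s.toJordanDecomposition.negPart + t.toJordanDecomposition.negPart) _ f]
  · rw [integral_add_measure (bcf_integrable f _) (bcf_integrable f _),
    integral_add_measure (bcf_integrable f _) (bcf_integrable f _)]
    unfold sigInt; ring
  · rw [Measure.toSignedMeasure_add, Measure.toSignedMeasure_add]
    conv_lhs => rw [sig_eq s, sig_eq t]
    abel

lemma sigInt_zero (f : BoundedContinuousFunction (Rn n) ℂ) :
    sigInt (0 : SignedMeasure (Rn n)) f = 0 := by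
  rw [sigInt_of_eq 0 0 0 (by simp) f]; simp

lemma sigInt_neg (s : SignedMeasure (Rn n)) (f : BoundedContinuousFunction (Rn n) ℂ) :
    sigInt (-s) f = - sigInt s f := by
  have := sigInt_add s (-s) f
  rw [add_neg_cancel, sigInt_zero] at this
  linear_combination -this

lemma sigInt_nnsmul (r : NNReal) (s : SignedMeasure (Rn n))
    (f : BoundedContinuousFunction (Rn n) ℂ) :
    sigInt (r • s) f = ((r : ℝ) : ℂ) * sigInt s f := by
  rw [sigInt_of_eq (r • s) (r • s.toJordanDecomposition.posPart)
    (r • s.toJordanDecomposition.negPart) _ f]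
  · rw [integral_smul_nnreal_measure, integral_smul_nnreal_measure]
    unfold sigInt
    simp only [NNReal.smul_def, Complex.real_smul]; ring
  · rw [Measure.toSignedMeasure_smul, Measure.toSignedMeasure_smul]
    conv_lhs => rw [sig_eq s]
    rw [smul_sub]

lemma sigInt_smul (r : ℝ) (s : SignedMeasure (Rn n))
    (f : BoundedContinuousFunction (Rn n) ℂ) :
    sigInt (r • s) f = (r : ℂ) * sigInt s f := by
  rcases le_total 0 r with h | h
  · lift r to NNReal using h
    exact sigInt_nnsmul r s f
  · obtain ⟨q, hq⟩ : ∃ q : NNReal, r = -(q : ℝ) := ⟨(-r).toNNReal, by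
      rw [Real.coe_toNNReal _ (by linarith)]; ring⟩
    subst hq
    have e : (-(q : ℝ)) • s = -((q : ℝ) • s) := by
      ext i hi
      simp
    rw [e, sigInt_neg]
    have := sigInt_nnsmul q s f
    rw [show ((q : ℝ) • s) = q • s from rfl, this]
    push_cast; ring

lemma sigInt_map (s : SignedMeasure (Rn n)) (g : Rn n → Rn n) (hg : Continuous g)
    (f : BoundedContinuousFunction (Rn n) ℂ) :
    sigInt (s.map g) f = sigInt s (fun x => f (g x)) := by
  rw [sigInt_of_eq (s.map g) (s.toJordanDecomposition.posPart.map g)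
    (s.toJordanDecomposition.negPart.map g) _ f]
  · rw [integral_map hg.aemeasurable (f.continuous.aestronglyMeasurable),
      integral_map hg.aemeasurable (f.continuous.aestronglyMeasurable)]
    rfl
  · ext i hi
    rw [VectorMeasure.map_apply _ hg.measurable hi, Measure.toSignedMeasure_sub_apply hi]
    conv_lhs => rw [sig_eq s]
    rw [Measure.toSignedMeasure_sub_apply (hg.measurable hi),
      map_measureReal_apply hg.measurable hi, map_measureReal_apply hg.measurable hi]

lemma cmIntegral_add (μ ν : ComplexMeasure (Rn n)) (f : BoundedContinuousFunction (Rn n) ℂ) :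
    cmIntegral (μ + ν) f = cmIntegral μ f + cmIntegral ν f := by
  simp only [cmIntegral_eq, map_add, sigInt_add]; ring

lemma cmIntegral_zero (f : BoundedContinuousFunction (Rn n) ℂ) :
    cmIntegral (0 : ComplexMeasure (Rn n)) f = 0 := by
  simp only [cmIntegral_eq, map_zero, sigInt_zero]; ring

lemma cmIntegral_smul (r : ℝ) (μ : ComplexMeasure (Rn n))
    (f : BoundedContinuousFunction (Rn n) ℂ) :
    cmIntegral (r • μ) f = (r : ℂ) * cmIntegral μ f := by
  simp only [cmIntegral_eq, map_smul, sigInt_smul]; ring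

lemma cmIntegral_sum {ι : Type*} (s : Finset ι) (μ : ι → ComplexMeasure (Rn n))
    (f : BoundedContinuousFunction (Rn n) ℂ) :
    cmIntegral (∑ i ∈ s, μ i) f = ∑ i ∈ s, cmIntegral (μ i) f := by
  classical
  induction s using Finset.induction_on with
  | empty => simp [cmIntegral_zero]
  | insert a s ha ih => rw [Finset.sum_insert ha, Finset.sum_insert ha, cmIntegral_add, ih]

lemma cmIntegral_map (μ : ComplexMeasure (Rn n)) (g : Rn n → Rn n) (hg : Continuous g)
    (f : BoundedContinuousFunction (Rn n) ℂ) :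
    cmIntegral (μ.map g) f = cmIntegral μ (fun x => f (g x)) := by
  have h1 : ComplexMeasure.re (μ.map g) = (ComplexMeasure.re μ).map g := by
    ext i hi
    rw [VectorMeasure.map_apply _ hg.measurable hi]
    simp [ComplexMeasure.re, VectorMeasure.mapRangeₗ, VectorMeasure.mapRange_apply,
      VectorMeasure.map_apply _ hg.measurable hi]
  have h2 : ComplexMeasure.im (μ.map g) = (ComplexMeasure.im μ).map g := by
    ext i hi
    rw [VectorMeasure.map_apply _ hg.measurable hi]
    simp [ComplexMeasure.im, VectorMeasure.mapRangeₗ, VectorMeasure.mapRange_apply,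
      VectorMeasure.map_apply _ hg.measurable hi]
  rw [cmIntegral_eq, cmIntegral_eq, h1, h2, sigInt_map _ g hg, sigInt_map _ g hg]

noncomputable def bcfC (g : BoundedContinuousFunction (Rn n) ℝ) :
    BoundedContinuousFunction (Rn n) ℂ :=
  BoundedContinuousFunction.ofNormedAddCommGroup (fun x => ((g x : ℝ) : ℂ))
    (Complex.continuous_ofReal.comp g.continuous) ‖g‖ (fun x => by
      simpa using g.norm_coe_le_norm x)

lemma sig_ext (s t : SignedMeasure (Rn n))
    (h : ∀ g : BoundedContinuousFunction (Rn n) ℝ, sigInt s (bcfC g) = sigInt t (bcfC g)) :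
    s = t := by
  have key : s.toJordanDecomposition.posPart + t.toJordanDecomposition.negPart
      = t.toJordanDecomposition.posPart + s.toJordanDecomposition.negPart := by
    apply ext_of_forall_integral_eq_of_IsFiniteMeasure
    intro g
    have := h g
    unfold sigInt bcfC at this
    simp only [BoundedContinuousFunction.coe_ofNormedAddCommGroup, integral_complex_ofReal] at this
    rw [integral_add_measure (g.integrable _) (g.integrable _),
      integral_add_measure (g.integrable _) (g.integrable _)]
    norm_cast at this
    linarith
  rw [sig_eq s, sig_eq t, sub_eq_sub_iff_add_eq_add]
  rw [← Measure.toSignedMeasure_add, ← Measure.toSignedMeasure_add]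
  exact Measure.toSignedMeasure_congr key

lemma sigInt_real (s : SignedMeasure (Rn n)) (g : BoundedContinuousFunction (Rn n) ℝ) :
    (sigInt s (bcfC g)).im = 0 := by
  unfold sigInt bcfC
  simp only [BoundedContinuousFunction.coe_ofNormedAddCommGroup, integral_complex_ofReal]
  simp

lemma cm_ext (μ ν : ComplexMeasure (Rn n))
    (h : ∀ f : BoundedContinuousFunction (Rn n) ℂ, cmIntegral μ f = cmIntegral ν f) : μ = ν := by
  have h1 : ComplexMeasure.re μ = ComplexMeasure.re ν := by
    apply sig_ext
    intro g
    have := congrArg Complex.re (h (bcfC g))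
    simp only [cmIntegral_eq, Complex.add_re, Complex.mul_re, sigInt_real, Complex.I_re,
      Complex.I_im] at this
    apply Complex.ext
    · linarith
    · simp [sigInt_real]
  have h2 : ComplexMeasure.im μ = ComplexMeasure.im ν := by
    apply sig_ext
    intro g
    have := congrArg Complex.im (h (bcfC g))
    simp only [cmIntegral_eq, Complex.add_im, Complex.mul_im, sigInt_real, Complex.I_re,
      Complex.I_im] at this
    apply Complex.ext
    · linarith
    · simp [sigInt_real]
  exact ComplexMeasure.equivSignedMeasure.injective (Prod.ext h1 h2)

/-- dominated convergence under dilation -/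
lemma cmIntegral_dilate (μ : ComplexMeasure (Rn n)) (f : BoundedContinuousFunction (Rn n) ℂ)
    (q : ℕ → ℝ) (t : ℝ) (hq : Tendsto q atTop (𝓝 t)) :
    Tendsto (fun i => cmIntegral μ (fun x => f (q i • x))) atTop
      (𝓝 (cmIntegral μ (fun x => f (t • x)))) := by
  have key : ∀ p : Measure (Rn n), IsFiniteMeasure p →
      Tendsto (fun i => ∫ x, f (q i • x) ∂p) atTop (𝓝 (∫ x, f (t • x) ∂p)) := by
    intro p hp
    apply tendsto_integral_of_dominated_convergence (fun _ => ‖f‖)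
    · intro i
      exact (f.continuous.comp (continuous_const_smul _)).aestronglyMeasurable
    · exact integrable_const _
    · intro i
      exact Eventually.of_forall fun x => f.norm_coe_le_norm _
    · refine Eventually.of_forall fun x => ?_
      exact (f.continuous.tendsto _).comp (hq.smul_const x)
  unfold cmIntegral
  exact ((key _ inferInstance).sub (key _ inferInstance)).add
    (((key _ inferInstance).sub (key _ inferInstance)).const_mul _)

end A


section B

lemma agree_of_cover {α : Type*} [MeasurableSpace α] (μ ν : VectorMeasure α ℂ) (Q : ℕ → Set α)
    (hQ : ∀ k, MeasurableSet (Q k))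
    (h : ∀ k s, MeasurableSet s → s ⊆ Q k → μ s = ν s) (s : Set α) (hs : MeasurableSet s)
    (hsQ : s ⊆ ⋃ k, Q k) : μ s = ν s := by
  have e : s = ⋃ k, (s ∩ disjointed Q k) := by
    rw [← Set.inter_iUnion, iUnion_disjointed, Set.inter_eq_left.2 hsQ]
  have hm : ∀ k, MeasurableSet (s ∩ disjointed Q k) := fun k =>
    hs.inter (MeasurableSet.disjointed hQ k)
  have hd : Pairwise (Function.onFun Disjoint fun k => s ∩ disjointed Q k) := fun i j hij =>
    (disjoint_disjointed Q hij).mono Set.inter_subset_right Set.inter_subset_right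
  rw [e, VectorMeasure.of_disjoint_iUnion hm hd, VectorMeasure.of_disjoint_iUnion hm hd]
  congr 1
  ext k
  exact h k _ (hm k) (Set.inter_subset_right.trans (disjointed_subset Q k))

def bx {ι : Type*} (u v : ι → ℝ) : Set (ι → ℝ) := Set.pi Set.univ (fun i => Set.Ico (u i) (v i))

lemma bx_meas {ι : Type*} [Fintype ι] (u v : ι → ℝ) : MeasurableSet (bx u v) :=
  MeasurableSet.univ_pi fun _ => measurableSet_Ico

lemma agree_on_box {ι : Type*} [Fintype ι] (μ ν : VectorMeasure (ι → ℝ) ℂ) (u v : ι → ℝ)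
    (h : ∀ u' v', bx u' v' ⊆ bx u v → μ (bx u' v') = ν (bx u' v')) (s : Set (ι → ℝ))
    (hs : MeasurableSet s) (hsv : s ⊆ bx u v) : μ s = ν s := by
  have hgen : MeasurableSpace.generateFrom
      (Set.pi Set.univ '' Set.pi Set.univ (fun _ : ι => Set.range (Set.Iio : ℝ → Set ℝ)))
      = MeasurableSpace.pi := by
    apply generateFrom_eq_pi
    · intro i
      rw [← borel_eq_generateFrom_Iio ℝ]
      exact (BorelSpace.measurable_eq).symm
    · intro i
      refine ⟨fun k : ℕ => Set.Iio (k : ℝ), fun k => ⟨_, rfl⟩, ?_⟩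
      rw [Set.eq_univ_iff_forall]
      intro x
      obtain ⟨k, hk⟩ := exists_nat_gt x
      exact Set.mem_iUnion.2 ⟨k, hk⟩
  have hpi : IsPiSystem (Set.pi Set.univ '' Set.pi Set.univ
      (fun _ : ι => Set.range (Set.Iio : ℝ → Set ℝ))) := by
    apply IsPiSystem.pi
    intro i
    rintro _ ⟨x, rfl⟩ _ ⟨y, rfl⟩ -
    exact ⟨min x y, by rw [Set.Iio_inter_Iio]⟩
  have key : μ.restrict (bx u v) = ν.restrict (bx u v) := by
    apply VectorMeasure.ext_of_generateFrom _ _ hgen.symm hpi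
    · simpa using h u v subset_rfl
    · rintro _ ⟨t, ht, rfl⟩
      simp only [Set.mem_pi, Set.mem_univ, true_implies, Set.mem_range] at ht
      choose c hc using ht
      have e : Set.pi Set.univ t ∩ bx u v = bx u (fun i => min (c i) (v i)) := by
        ext x
        simp only [bx, Set.mem_inter_iff, Set.mem_pi, Set.mem_univ, true_implies, ← hc,
          Set.mem_Iio, Set.mem_Ico, lt_min_iff]
        constructor
        · intro h i; exact ⟨(h.2 i).1, h.1 i, (h.2 i).2⟩
        · intro h; exact ⟨fun i => (h i).2.1, fun i => ⟨(h i).1, (h i).2.2⟩⟩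
      have hm : MeasurableSet (Set.pi Set.univ t) :=
        MeasurableSet.univ_pi fun i => by rw [← hc i]; exact measurableSet_Iio
      rw [VectorMeasure.restrict_apply _ (bx_meas u v) hm,
        VectorMeasure.restrict_apply _ (bx_meas u v) hm, e]
      apply h
      rw [← e]
      exact Set.inter_subset_right
  have h2 := congrArg (fun m : VectorMeasure (ι → ℝ) ℂ => m s) key
  rwa [VectorMeasure.restrict_eq_self _ (bx_meas u v) hs hsv,
    VectorMeasure.restrict_eq_self _ (bx_meas u v) hs hsv] at h2

lemma agree_on_open {ι : Type*} [Fintype ι] (μ ν : VectorMeasure (ι → ℝ) ℂ) (O : Set (ι → ℝ))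
    (hO : IsOpen O)
    (h : ∀ u v, (∀ i, u i < v i) → bx u v ⊆ O → μ (bx u v) = ν (bx u v)) (s : Set (ι → ℝ))
    (hs : MeasurableSet s) (hsO : s ⊆ O) : μ s = ν s := by
  have h' : ∀ u v, bx u v ⊆ O → μ (bx u v) = ν (bx u v) := by
    intro u v huv
    by_cases hlt : ∀ i, u i < v i
    · exact h u v hlt huv
    · push Not at hlt
      obtain ⟨i, hi⟩ := hlt
      have : bx u v = ∅ := by
        rw [Set.eq_empty_iff_forall_notMem]
        intro x hx
        have := hx i (Set.mem_univ i)
        exact absurd (this.1.trans_lt this.2) (not_lt.2 hi)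
      simp [this]
  classical
  obtain ⟨e, he⟩ := exists_surjective_nat ((ι → ℚ) × (ι → ℚ))
  let B : ((ι → ℚ) × (ι → ℚ)) → Set (ι → ℝ) := fun q =>
    bx (fun i => (q.1 i : ℝ)) (fun i => (q.2 i : ℝ))
  let Q : ℕ → Set (ι → ℝ) := fun k => if B (e k) ⊆ O then B (e k) else ∅
  apply agree_of_cover μ ν Q _ _ s hs
  · intro x hx
    obtain ⟨ε, hε, hball⟩ := Metric.isOpen_iff.1 hO x (hsO hx)
    have h1 : ∀ i, ∃ q : ℚ, x i - ε < q ∧ (q : ℝ) < x i := fun i =>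
      exists_rat_btwn (by linarith)
    have h2 : ∀ i, ∃ q : ℚ, x i < q ∧ (q : ℝ) < x i + ε := fun i =>
      exists_rat_btwn (by linarith)
    choose q hq using h1
    choose r hr using h2
    obtain ⟨k, hk⟩ := he (q, r)
    have hsub : B (e k) ⊆ O := by
      intro y hy
      apply hball
      rw [hk] at hy
      rw [Metric.mem_ball, dist_pi_lt_iff hε]
      intro i
      have hyi := hy i (Set.mem_univ i)
      simp only [Set.mem_Ico] at hyi
      rw [Real.dist_eq, abs_lt]
      constructor <;> linarith [(hq i).1, (hq i).2, (hr i).1, (hr i).2]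
    rw [Set.mem_iUnion]
    refine ⟨k, ?_⟩
    simp only [Q, if_pos hsub, hk]
    intro i _
    exact ⟨(hq i).2.le, (hr i).1⟩
  · intro k
    simp only [Q]
    split_ifs
    · exact bx_meas _ _
    · exact MeasurableSet.empty
  · intro k t ht htQ
    simp only [Q] at htQ
    split_ifs at htQ with hh
    · exact agree_on_box μ ν _ _ (fun u' v' h'' => h' u' v' (h''.trans hh)) t ht htQ
    · rw [Set.subset_empty_iff.1 htQ]; simp

end B


section C
variable {n : ℕ}

abbrev tr (v : Rn n) (β : Set (Rn n)) : Set (Rn n) := (fun y => y + v) '' β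

lemma tr_meas (v : Rn n) {β : Set (Rn n)} (h : MeasurableSet β) : MeasurableSet (tr v β) :=
  (MeasurableEquiv.addRight v).measurableEmbedding.measurableSet_image.2 h

lemma tr_neg_tr (v : Rn n) (β : Set (Rn n)) : tr (-v) (tr v β) = β := by
  rw [tr, tr, Set.image_image]
  simp only [add_neg_cancel_right, Set.image_id']

lemma tr_body (v : Rn n) {K : Set (Rn n)} (h : IsConvexBody K) : IsConvexBody (tr v K) := by
  refine ⟨h.1.image _, h.2.1.image (by fun_prop), ?_⟩
  simpa [tr, add_comm] using h.2.2.translate v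

lemma local_shift (Φ : CurvatureMeasure n) {K L U : Set (Rn n)} (hK : IsConvexBody K)
    (hL : IsConvexBody L) (hU : IsOpen U) (v : Rn n)
    (h : ∀ x ∈ U, x ∈ K ↔ x + v ∈ L) {β : Set (Rn n)} (hβ : MeasurableSet β) (hβU : β ⊆ U) :
    Φ.meas K β = Φ.meas L (tr v β) := by
  have h1 := Φ.translation_invariant L hL (-v) (tr v β) (tr_meas v hβ)
  change Φ.meas (tr (-v) L) (tr (-v) (tr v β)) = _ at h1
  rw [tr_neg_tr] at h1
  rw [← h1]
  apply Φ.locality K _ U hK (tr_body _ hL) hU _ β hβ hβU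
  ext x
  simp only [Set.mem_inter_iff, and_congr_left_iff]
  intro hx
  rw [h x hx]
  constructor
  · intro hh; exact ⟨x + v, hh, by simp⟩
  · rintro ⟨y, hy, rfl⟩; simpa using hy

lemma supp_bdd (Φ : CurvatureMeasure n) {K : Set (Rn n)} (hK : IsConvexBody K)
    {β : Set (Rn n)} (hβ : MeasurableSet β) (hβK : β ⊆ Kᶜ) (r : ℝ) (hr : β ⊆ ball 0 r) :
    Φ.meas K β = 0 := by
  rcases subsingleton_or_nontrivial (Rn n) with hs | hs
  · have : β = ∅ := by
      rw [Set.eq_empty_iff_forall_notMem]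
      intro x hx
      obtain ⟨y, hy⟩ := hK.1
      exact hβK hx (by rwa [Subsingleton.elim x y])
    simp [this]
  obtain ⟨e, he⟩ := exists_norm_eq (Rn n) (zero_le_one' ℝ)
  obtain ⟨R, hR⟩ := hK.2.1.isBounded.subset_ball (0 : Rn n)
  set T : ℝ := |R| + 2 * |r| + 1 with hT
  have hTpos : 0 < T := by positivity
  let x : ℕ → Rn n := fun j => ((j + 1 : ℝ) * T) • e
  have hx : ∀ j, Φ.meas K β = Φ.meas K (tr (x j) β) := by
    intro j
    apply local_shift Φ hK hK (U := Kᶜ ∩ ball 0 r) (hK.2.1.isClosed.isOpen_compl.inter isOpen_ball)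
      (x j) _ hβ (Set.subset_inter hβK hr)
    rintro y ⟨hy1, hy2⟩
    refine ⟨fun h => absurd h hy1, fun h => ?_⟩
    exfalso
    have h1 := hR h
    rw [mem_ball_zero_iff] at h1 hy2
    have h2 : ‖x j‖ = (j + 1 : ℝ) * T := by
      simp only [x, norm_smul, he, mul_one, Real.norm_eq_abs]
      exact abs_of_pos (by positivity)
    have h3 : ‖x j‖ ≤ ‖y + x j‖ + ‖y‖ := by
      have := norm_sub_le (y + x j) y
      simpa using this
    have h4 : T ≤ (j + 1 : ℝ) * T := by
      nlinarith [(Nat.cast_nonneg j : (0 : ℝ) ≤ j)]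
    have := le_abs_self R
    have := le_abs_self r
    have := abs_nonneg r
    linarith
  have hd : Pairwise (Function.onFun Disjoint fun j => tr (x j) β) := by
    intro i j hij
    rw [Function.onFun, Set.disjoint_left]
    rintro _ ⟨y, hy, rfl⟩ ⟨z, hz, hzy⟩
    have h1 := mem_ball_zero_iff.1 (hr hy)
    have h2 := mem_ball_zero_iff.1 (hr hz)
    have h3 : z - y = ((i - j : ℝ) * T) • e := by
      have : z - y = x i - x j := by
        simp only at hzy
        rw [sub_eq_sub_iff_add_eq_add, hzy, add_comm]
      rw [this]
      simp only [x, ← sub_smul]; congr 1; ring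
    have h4 : ‖z - y‖ = |(i - j : ℝ)| * T := by
      rw [h3, norm_smul, he, mul_one, Real.norm_eq_abs, abs_mul, abs_of_pos hTpos]
    have h5 : (1 : ℝ) ≤ |(i - j : ℝ)| := by
      have : (1 : ℤ) ≤ |(i - j : ℤ)| := Int.one_le_abs (by omega)
      exact_mod_cast this
    have h6 := norm_sub_le z y
    have := le_abs_self r
    have := abs_nonneg R
    nlinarith
  have hsum := (VectorMeasure.hasSum_of_disjoint_iUnion (v := Φ.meas K)
    (fun j => tr_meas (x j) hβ) hd).summable
  have := hsum.tendsto_atTop_zero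
  simp only [← hx] at this
  exact tendsto_nhds_unique tendsto_const_nhds this

lemma supp_zero (Φ : CurvatureMeasure n) {K : Set (Rn n)} (hK : IsConvexBody K)
    {β : Set (Rn n)} (hβ : MeasurableSet β) (hβK : β ⊆ Kᶜ) : Φ.meas K β = 0 := by
  have := agree_of_cover (Φ.meas K) 0 (fun k : ℕ => Kᶜ ∩ ball 0 (k : ℝ))
    (fun k => hK.2.1.isClosed.measurableSet.compl.inter measurableSet_ball)
    (fun k s hs hsQ => by
      simpa using supp_bdd Φ hK hs (hsQ.trans Set.inter_subset_left) k
        (hsQ.trans Set.inter_subset_right)) β hβ (by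
      intro x hx
      obtain ⟨k, hk⟩ := exists_nat_gt ‖x‖
      exact Set.mem_iUnion.2 ⟨k, hβK hx, by simpa using hk⟩)
  simpa using this

variable {I : Type} [Fintype I]

def poly (a : I → Rn n →L[ℝ] ℝ) (b : I → ℝ) : Set (Rn n) := {x | ∀ i, a i x ≤ b i}

def st (a : I → Rn n →L[ℝ] ℝ) (b : I → ℝ) (S : Finset I) : Set (Rn n) :=
  {x | (∀ i ∈ S, a i x = b i) ∧ ∀ i, i ∉ S → a i x < b i}

lemma st_meas (a : I → Rn n →L[ℝ] ℝ) (b : I → ℝ) (S : Finset I) : MeasurableSet (st a b S) := by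
  classical
  have : st a b S = (⋂ i ∈ S, {x | a i x = b i}) ∩ ⋂ i ∈ Sᶜ, {x | a i x < b i} := by
    ext x; simp [st]
  rw [this]
  apply MeasurableSet.inter
  · exact Finset.measurableSet_biInter _ fun i _ =>
      (isClosed_eq (a i).continuous continuous_const).measurableSet
  · exact Finset.measurableSet_biInter _ fun i _ =>
      (isOpen_lt (a i).continuous continuous_const).measurableSet

lemma local_stratum (Φ : CurvatureMeasure n) (a : I → Rn n →L[ℝ] ℝ) (b b' : I → ℝ)
    (h1 : IsConvexBody (poly a b)) (h2 : IsConvexBody (poly a b')) (S : Finset I)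
    (v : Rn n) (hv : ∀ i ∈ S, a i v = b' i - b i) {β : Set (Rn n)} (hβ : MeasurableSet β)
    (hb : β ⊆ st a b S) (hb' : tr v β ⊆ st a b' S) :
    Φ.meas (poly a b) β = Φ.meas (poly a b') (tr v β) := by
  classical
  apply local_shift Φ h1 h2 (U := ⋂ i ∈ Sᶜ, {x | a i x < b i ∧ a i (x + v) < b' i}) _ v _ hβ
  · intro x hx
    have hx1 := (hb hx).2
    have hx2 := (hb' ⟨x, hx, rfl⟩).2
    simp only [Set.mem_iInter, Finset.mem_compl]
    exact fun i hi => ⟨hx1 i hi, hx2 i hi⟩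
  · exact isOpen_biInter_finset fun i _ =>
      (isOpen_lt (a i).continuous continuous_const).inter
        (isOpen_lt ((a i).continuous.comp (by fun_prop)) continuous_const)
  · intro x hx
    simp only [Set.mem_iInter, Finset.mem_compl] at hx
    simp only [poly, Set.mem_ofPred_eq]
    apply forall_congr'
    intro i
    by_cases hi : i ∈ S
    · rw [map_add, hv i hi]
      constructor <;> intro h <;> linarith
    · obtain ⟨h3, h4⟩ := hx i hi
      exact ⟨fun _ => h4.le, fun _ => h3.le⟩

end C


section D
variable {n : ℕ}

lemma smul_body {t : ℝ} {K : Set (Rn n)} (h : IsConvexBody K) : IsConvexBody (t • K) :=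
  ⟨h.1.smul_set, h.2.1.smul t, h.2.2.smul t⟩

variable {I : Type} [Fintype I]

lemma smul_poly (a : I → Rn n →L[ℝ] ℝ) (b : I → ℝ) {t : ℝ} (ht : 0 < t) :
    t • poly a b = poly a (fun i => t * b i) := by
  ext x
  rw [Set.mem_smul_set_iff_inv_smul_mem₀ ht.ne']
  simp only [poly, Set.mem_ofPred_eq, map_smul, smul_eq_mul]
  apply forall_congr'
  intro i
  rw [inv_mul_le_iff₀ ht]

lemma smul_st (a : I → Rn n →L[ℝ] ℝ) (b : I → ℝ) (S : Finset I) {t : ℝ} (ht : 0 < t) :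
    t • st a b S = st a (fun i => t * b i) S := by
  ext x
  rw [Set.mem_smul_set_iff_inv_smul_mem₀ ht.ne']
  simp only [st, Set.mem_ofPred_eq, map_smul, smul_eq_mul]
  apply and_congr
  · refine forall_congr' fun i => forall_congr' fun _ => ?_
    rw [inv_mul_eq_iff_eq_mul₀ ht.ne']
  · refine forall_congr' fun i => forall_congr' fun _ => ?_
    rw [inv_mul_lt_iff₀ ht]

/-- the tiling of a dilated box -/
lemma tile_union {d : ℕ} (E : (Fin d → ℝ) →ₗ[ℝ] Rn n) (p : Rn n) (u v : Fin d → ℝ)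
    (huv : ∀ i, u i < v i) (m : ℕ) (hm : 0 < m) :
    (m : ℝ) • ((fun c => p + E c) '' bx u v) =
      ⋃ k : Fin d → Fin m, tr (((m : ℝ) - 1) • p +
        E (fun i => ((m : ℝ) - 1) * u i + (v i - u i) * (k i : ℕ))) ((fun c => p + E c) '' bx u v) := by
  have hm' : (0 : ℝ) < m := by exact_mod_cast hm
  ext x
  constructor
  · rintro ⟨_, ⟨c, hc, rfl⟩, rfl⟩
    have hk : ∀ i, ∃ k : Fin m, (k : ℕ) * (v i - u i) ≤ m * (c i - u i) ∧
        m * (c i - u i) < ((k : ℕ) + 1) * (v i - u i) := by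
      intro i
      have hw : 0 < v i - u i := sub_pos.2 (huv i)
      obtain ⟨h1, h2⟩ := hc i (Set.mem_univ i)
      have h0 : 0 ≤ m * (c i - u i) / (v i - u i) := by
        apply div_nonneg _ hw.le
        apply mul_nonneg hm'.le; linarith
      have hlt : m * (c i - u i) / (v i - u i) < m := by
        rw [div_lt_iff₀ hw]
        apply mul_lt_mul_of_pos_left _ hm'
        linarith
      refine ⟨⟨⌊m * (c i - u i) / (v i - u i)⌋₊, (Nat.floor_lt h0).2 hlt⟩, ?_, ?_⟩
      · rw [← le_div_iff₀ hw]; exact Nat.floor_le h0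
      · rw [← div_lt_iff₀ hw]; exact Nat.lt_floor_add_one _
    choose k hk using hk
    rw [Set.mem_iUnion]
    refine ⟨k, _, ⟨fun i => m * c i - ((m : ℝ) - 1) * u i - (v i - u i) * (k i : ℕ), ?_, rfl⟩, ?_⟩
    · intro i _
      obtain ⟨h1, h2⟩ := hk i
      constructor <;> nlinarith
    · simp only
      have : (fun i => m * c i - ((m : ℝ) - 1) * u i - (v i - u i) * (k i : ℕ)) =
        (m : ℝ) • c - (fun i => ((m : ℝ) - 1) * u i + (v i - u i) * (k i : ℕ)) := by
        ext i; simp; ring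
      rw [this, map_sub, map_smul]
      module
  · rw [Set.mem_iUnion]
    rintro ⟨k, _, ⟨c, hc, rfl⟩, rfl⟩
    refine ⟨_, ⟨fun i => (m : ℝ)⁻¹ * (c i + ((m : ℝ) - 1) * u i + (v i - u i) * (k i : ℕ)),
      ?_, rfl⟩, ?_⟩
    · intro i _
      obtain ⟨h1, h2⟩ := hc i (Set.mem_univ i)
      have hw : 0 < v i - u i := sub_pos.2 (huv i)
      have hk0 : (0 : ℝ) ≤ (k i : ℕ) := Nat.cast_nonneg _
      have hk1 : ((k i : ℕ) : ℝ) + 1 ≤ m := by exact_mod_cast (k i).2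
      constructor
      · rw [le_inv_mul_iff₀ hm']; nlinarith
      · rw [inv_mul_lt_iff₀ hm']; nlinarith
    · simp only
      have : (fun i => (m : ℝ)⁻¹ * (c i + ((m : ℝ) - 1) * u i + (v i - u i) * (k i : ℕ))) =
        (m : ℝ)⁻¹ • (c + (fun i => ((m : ℝ) - 1) * u i + (v i - u i) * (k i : ℕ))) := by
        ext i; simp; left; ring
      rw [this, map_smul, map_add, smul_add, smul_inv_smul₀ hm'.ne']
      module

lemma tile_disj {d : ℕ} (E : (Fin d → ℝ) →ₗ[ℝ] Rn n) (hE : Function.Injective E) (p : Rn n)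
    (u v : Fin d → ℝ) (huv : ∀ i, u i < v i) (m : ℕ) :
    Pairwise (Function.onFun Disjoint fun k : Fin d → Fin m => tr (((m : ℝ) - 1) • p +
        E (fun i => ((m : ℝ) - 1) * u i + (v i - u i) * (k i : ℕ)))
          ((fun c => p + E c) '' bx u v)) := by
  intro k l hkl
  rw [Function.onFun, Set.disjoint_left]
  rintro _ ⟨_, ⟨c, hc, rfl⟩, rfl⟩ ⟨_, ⟨c', hc', rfl⟩, h⟩
  simp only at h
  have h2 : E (c' + (fun i => ((m : ℝ) - 1) * u i + (v i - u i) * (l i : ℕ))) =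
    E (c + (fun i => ((m : ℝ) - 1) * u i + (v i - u i) * (k i : ℕ))) := by
    rw [map_add, map_add]
    have e1 : ∀ x y : Rn n, x + y = (p + x + (((m : ℝ) - 1) • p + y)) - (m : ℝ) • p := by
      intro x y; module
    rw [e1, h, ← e1]
  have h3 := hE h2
  apply hkl
  ext i
  have h4 := congrFun h3 i
  simp only [Pi.add_apply] at h4
  obtain ⟨h5, h6⟩ := hc i (Set.mem_univ i)
  obtain ⟨h7, h8⟩ := hc' i (Set.mem_univ i)
  have hw : 0 < v i - u i := sub_pos.2 (huv i)
  have A : ((k i : ℕ) : ℝ) < (l i : ℕ) + 1 := by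
    by_contra hh
    push Not at hh
    nlinarith
  have B : ((l i : ℕ) : ℝ) < (k i : ℕ) + 1 := by
    by_contra hh
    push Not at hh
    nlinarith
  have A' : (k i : ℕ) < (l i : ℕ) + 1 := by exact_mod_cast A
  have B' : (l i : ℕ) < (k i : ℕ) + 1 := by exact_mod_cast B
  omega

def dirS (a : I → Rn n →L[ℝ] ℝ) (S : Finset I) : Submodule ℝ (Rn n) :=
  ⨅ i ∈ S, LinearMap.ker (a i : Rn n →ₗ[ℝ] ℝ)

lemma mem_dirS (a : I → Rn n →L[ℝ] ℝ) (S : Finset I) (x : Rn n) :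
    x ∈ dirS a S ↔ ∀ i ∈ S, a i x = 0 := by
  simp [dirS, Submodule.mem_iInf]

lemma smul_meas {t : ℝ} (ht : t ≠ 0) {β : Set (Rn n)} (hβ : MeasurableSet β) :
    MeasurableSet (t • β) := hβ.const_smul₀ t

noncomputable def dil (t : ℝ) (μ : ComplexMeasure (Rn n)) : ComplexMeasure (Rn n) :=
  μ.map (fun x => t⁻¹ • x)

lemma dil_apply {t : ℝ} (ht : t ≠ 0) (μ : ComplexMeasure (Rn n)) {β : Set (Rn n)}
    (hβ : MeasurableSet β) : dil t μ β = μ (t • β) := by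
  rw [dil, VectorMeasure.map_apply _ (by fun_prop) hβ]
  congr 1
  exact Set.preimage_smul_inv₀ ht β

lemma stratum_scale (Φ : CurvatureMeasure n) (a : I → Rn n →L[ℝ] ℝ) (b : I → ℝ)
    (h1 : IsConvexBody (poly a b)) (S : Finset I) (m : ℕ) (hm : 0 < m)
    {β : Set (Rn n)} (hβ : MeasurableSet β) (hb : β ⊆ st a b S) :
    Φ.meas ((m : ℝ) • poly a b) ((m : ℝ) • β)
      = (m : ℂ) ^ (Module.finrank ℝ (dirS a S)) * Φ.meas (poly a b) β := by
  have hm' : (0 : ℝ) < m := by exact_mod_cast hm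
  rcases (st a b S).eq_empty_or_nonempty with he | ⟨p, hp⟩
  · have : β = ∅ := Set.subset_empty_iff.1 (hb.trans he.subset)
    simp [this]
  set d := Module.finrank ℝ (dirS a S) with hd
  let bs := Module.finBasis ℝ (dirS a S)
  let E : (Fin d → ℝ) →ₗ[ℝ] Rn n :=
    (dirS a S).subtype ∘ₗ (bs.equivFun.symm : (Fin d → ℝ) →ₗ[ℝ] dirS a S)
  have hEinj : Function.Injective E :=
    (dirS a S).injective_subtype.comp bs.equivFun.symm.injective
  have hEmem : ∀ c, E c ∈ dirS a S := fun c => (bs.equivFun.symm c).2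
  have hEsurj : ∀ x ∈ dirS a S, ∃ c, E c = x := fun x hx =>
    ⟨bs.equivFun ⟨x, hx⟩, by simp [E]⟩
  have hEc : Continuous E := LinearMap.continuous_of_finiteDimensional E
  obtain ⟨L, hL⟩ := LinearMap.exists_leftInverse_of_injective E (LinearMap.ker_eq_bot.2 hEinj)
  have hL' : ∀ c, L (E c) = c := fun c => LinearMap.congr_fun hL c
  have hLc : Continuous L := LinearMap.continuous_of_finiteDimensional L
  let ψ : (Fin d → ℝ) → Rn n := fun c => p + E c
  have hψc : Continuous ψ := by fun_prop
  let F : Rn n → (Fin d → ℝ) := fun x => L (x - p)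
  have hFc : Continuous F := by fun_prop
  have hFψ : ∀ c, F (ψ c) = c := fun c => by simp [F, ψ, hL']
  have hψF : ∀ x ∈ st a b S, ψ (F x) = x := by
    intro x hx
    obtain ⟨c, hc⟩ := hEsurj (x - p) (by
      rw [mem_dirS]
      intro i hi
      rw [map_sub, hx.1 i hi, hp.1 i hi, sub_self])
    simp only [F, ψ, ← hc, hL']
    rw [hc]; simp
  have haψ : ∀ c, ∀ i ∈ S, a i (ψ c) = b i := by
    intro c i hi
    simp only [ψ, map_add, hp.1 i hi, (mem_dirS a S _).1 (hEmem c) i hi, add_zero]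
  let O : Set (Fin d → ℝ) := ψ ⁻¹' (st a b S)
  have hO : IsOpen O := by
    classical
    have : O = ⋂ i ∈ Sᶜ, {c | a i (ψ c) < b i} := by
      ext c
      simp only [O, st, Set.mem_preimage, Set.mem_ofPred_eq, Set.mem_iInter, Finset.mem_compl]
      exact ⟨fun h => h.2, fun h => ⟨haψ c, h⟩⟩
    rw [this]
    exact isOpen_biInter_finset fun i _ =>
      isOpen_lt ((a i).continuous.comp hψc) continuous_const
  have hst := st_meas a b S
  let M1 : VectorMeasure (Fin d → ℝ) ℂ :=
    (((m : ℂ) ^ d) • (Φ.meas (poly a b)).restrict (st a b S)).map F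
  let M2 : VectorMeasure (Fin d → ℝ) ℂ :=
    ((dil (m : ℝ) (Φ.meas ((m : ℝ) • poly a b))).restrict (st a b S)).map F
  have hM1 : ∀ s, MeasurableSet s →
      M1 s = (m : ℂ) ^ d * Φ.meas (poly a b) (F ⁻¹' s ∩ st a b S) := by
    intro s hs
    simp only [M1]
    rw [VectorMeasure.map_apply _ hFc.measurable hs, VectorMeasure.coe_smul, Pi.smul_apply,
      VectorMeasure.restrict_apply _ hst (hFc.measurable hs), smul_eq_mul]
  have hM2 : ∀ s, MeasurableSet s →
      M2 s = Φ.meas ((m : ℝ) • poly a b) ((m : ℝ) • (F ⁻¹' s ∩ st a b S)) := by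
    intro s hs
    simp only [M2]
    rw [VectorMeasure.map_apply _ hFc.measurable hs,
      VectorMeasure.restrict_apply _ hst (hFc.measurable hs),
      dil_apply hm'.ne' _ ((hFc.measurable hs).inter hst)]
  have hFs : ∀ s ⊆ O, F ⁻¹' s ∩ st a b S = ψ '' s := by
    intro s hs
    ext x
    constructor
    · rintro ⟨h, hx⟩; exact ⟨F x, h, hψF x hx⟩
    · rintro ⟨c, hc, rfl⟩
      exact ⟨by simpa [hFψ] using hc, hs hc⟩
  have key : ∀ s, MeasurableSet s → s ⊆ O → M1 s = M2 s := by
    apply agree_on_open M1 M2 O hO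
    intro u v huv hB
    rw [hM1 _ (bx_meas u v), hM2 _ (bx_meas u v), hFs _ hB]
    have hψB : MeasurableSet (ψ '' bx u v) := by
      rw [← hFs _ hB]; exact (hFc.measurable (bx_meas u v)).inter hst
    have hψBst : ψ '' bx u v ⊆ st a b S := by
      rintro _ ⟨c, hc, rfl⟩; exact hB hc
    have hU := tile_union E p u v huv m hm
    rw [hU, VectorMeasure.of_disjoint_iUnion (fun k => tr_meas _ hψB)
      (tile_disj E hEinj p u v huv m), tsum_fintype]
    have hterm : ∀ k : Fin d → Fin m, Φ.meas ((m : ℝ) • poly a b) (tr (((m : ℝ) - 1) • p +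
        E (fun i => ((m : ℝ) - 1) * u i + (v i - u i) * (k i : ℕ))) (ψ '' bx u v))
        = Φ.meas (poly a b) (ψ '' bx u v) := by
      intro k
      rw [smul_poly a b hm']
      symm
      apply local_stratum Φ a b _ h1 _ S _ _ hψB hψBst
      · rw [← smul_st a b S hm']
        refine Set.Subset.trans ?_ (Set.smul_set_mono hψBst)
        rw [hU]
        exact Set.subset_iUnion (fun k : Fin d → Fin m => tr (((m : ℝ) - 1) • p +
          E (fun i => ((m : ℝ) - 1) * u i + (v i - u i) * (k i : ℕ))) (ψ '' bx u v)) k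
      · rw [← smul_poly a b hm']; exact smul_body h1
      · intro i hi
        rw [map_add, map_smul, hp.1 i hi, (mem_dirS a S _).1 (hEmem _) i hi, smul_eq_mul]
        ring
    rw [Finset.sum_congr rfl fun k _ => hterm k]
    simp
  have hfin : F ⁻¹' (ψ ⁻¹' β) ∩ st a b S = β := by
    ext x
    constructor
    · rintro ⟨h, hx⟩
      rw [Set.mem_preimage, Set.mem_preimage, hψF x hx] at h; exact h
    · intro h
      exact ⟨by rw [Set.mem_preimage, Set.mem_preimage, hψF x (hb h)]; exact h, hb h⟩
  have := key (ψ ⁻¹' β) (hψc.measurable hβ) (Set.preimage_mono hb)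
  rw [hM1 _ (hψc.measurable hβ), hM2 _ (hψc.measurable hβ), hfin] at this
  exact this.symm

end D


section E
variable {n : ℕ}

lemma vm_sum_apply {ι : Type*} (s : Finset ι) (c : ι → ℝ) (μ : ι → ComplexMeasure (Rn n))
    (β : Set (Rn n)) : (∑ i ∈ s, c i • μ i) β = ∑ i ∈ s, (c i : ℂ) * μ i β := by
  classical
  induction s using Finset.induction_on with
  | empty => simp
  | insert a s ha ih =>
    rw [Finset.sum_insert ha, Finset.sum_insert ha, _root_.add_apply, ih, _root_.smul_apply,
      Complex.real_smul]

lemma poly_rel {I : Type} [Fintype I] (Φ : CurvatureMeasure n) (a : I → Rn n →L[ℝ] ℝ) (b : I → ℝ)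
    (h1 : IsConvexBody (poly a b)) :
    ∃ ν : Fin (n + 1) → ComplexMeasure (Rn n), ∀ m : ℕ, 0 < m →
      dil (m : ℝ) (Φ.meas ((m : ℝ) • poly a b)) = ∑ k : Fin (n + 1), ((m : ℝ) ^ (k : ℕ)) • ν k := by
  classical
  have hdim : ∀ S : Finset I, Module.finrank ℝ (dirS a S) < n + 1 := by
    intro S
    have := Submodule.finrank_le (dirS a S)
    rw [finrank_euclideanSpace_fin] at this
    omega
  let g : Finset I → Fin (n + 1) := fun S => ⟨Module.finrank ℝ (dirS a S), hdim S⟩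
  refine ⟨fun k => ∑ S with g S = k, (1 : ℝ) • (Φ.meas (poly a b)).restrict (st a b S), ?_⟩
  intro m hm
  have hm' : (0 : ℝ) < m := by exact_mod_cast hm
  ext β hβ
  rw [vm_sum_apply]
  simp only [vm_sum_apply]
  rw [dil_apply hm'.ne' _ hβ]
  have hdisj : Pairwise (Function.onFun Disjoint fun S : Finset I => (m : ℝ) • (β ∩ st a b S)) := by
    intro S T hST
    rw [Function.onFun, Set.disjoint_left]
    rintro _ ⟨x, ⟨_, hx⟩, rfl⟩ hy
    rw [Set.smul_mem_smul_set_iff₀ hm'.ne'] at hy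
    apply hST
    ext i
    have hy := hy.2
    constructor
    · intro hi
      by_contra hi'
      exact absurd (hx.1 i hi) (hy.2 i hi').ne
    · intro hi
      by_contra hi'
      exact absurd (hy.1 i hi) (hx.2 i hi').ne
  have hmeas : ∀ S : Finset I, MeasurableSet ((m : ℝ) • (β ∩ st a b S)) := fun S =>
    smul_meas hm'.ne' (hβ.inter (st_meas a b S))
  have hcover : (m : ℝ) • β ∩ (m : ℝ) • poly a b = ⋃ S : Finset I, (m : ℝ) • (β ∩ st a b S) := by
    rw [← Set.smul_set_inter₀ hm'.ne', ← Set.smul_set_iUnion, ← Set.inter_iUnion]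
    congr 2
    ext x
    rw [Set.mem_iUnion]
    constructor
    · intro hx
      refine ⟨Finset.univ.filter fun i => a i x = b i, ?_, ?_⟩
      · intro i hi; simpa using hi
      · intro i hi
        exact lt_of_le_of_ne (hx i) (by simpa using hi)
    · rintro ⟨S, hS⟩ i
      by_cases hi : i ∈ S
      · exact (hS.1 i hi).le
      · exact (hS.2 i hi).le
  have hbody : IsConvexBody ((m : ℝ) • poly a b) := smul_body h1
  have hP : MeasurableSet ((m : ℝ) • poly a b) := hbody.2.1.isClosed.measurableSet
  have hmb : MeasurableSet ((m : ℝ) • β) := smul_meas hm'.ne' hβ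
  have e1 : Φ.meas ((m : ℝ) • poly a b) ((m : ℝ) • β)
      = Φ.meas ((m : ℝ) • poly a b) ((m : ℝ) • β ∩ (m : ℝ) • poly a b) := by
    conv_lhs => rw [← Set.inter_union_sdiff ((m : ℝ) • β) ((m : ℝ) • poly a b)]
    rw [VectorMeasure.of_union Set.disjoint_sdiff_inter.symm (hmb.inter hP) (hmb.diff hP),
      supp_zero Φ hbody (hmb.diff hP) (fun x hx => hx.2), add_zero]
  rw [e1, hcover, VectorMeasure.of_disjoint_iUnion hmeas hdisj, tsum_fintype]
  rw [← Finset.sum_fiberwise Finset.univ g]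
  apply Finset.sum_congr rfl
  intro k _
  rw [Finset.mul_sum]
  apply Finset.sum_congr rfl
  intro S hS
  have hS : g S = k := by simpa using hS
  rw [stratum_scale Φ a b h1 S m hm (hβ.inter (st_meas a b S)) Set.inter_subset_right,
    VectorMeasure.restrict_apply _ (st_meas a b S) hβ, ← hS]
  simp [g]

lemma exists_W (n : ℕ) : ∃ W : Fin (n + 1) → Fin (n + 1) → ℝ, ∀ k l : Fin (n + 1),
    ∑ j, W k j * ((j : ℕ) + 1 : ℝ) ^ (l : ℕ) = if k = l then 1 else 0 := by
  let A := Matrix.vandermonde (fun j : Fin (n + 1) => ((j : ℕ) + 1 : ℝ))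
  have hA : A.det ≠ 0 := by
    rw [Matrix.det_vandermonde_ne_zero_iff]
    intro i j h
    simp only [add_left_inj, Nat.cast_inj] at h
    exact Fin.ext h
  refine ⟨fun k j => A⁻¹ k j, fun k l => ?_⟩
  have := congrFun (congrFun (Matrix.nonsing_inv_mul A (isUnit_iff_ne_zero.2 hA)) k) l
  rw [Matrix.mul_apply, Matrix.one_apply] at this
  simpa [A, Matrix.vandermonde_apply] using this

lemma approx {K : Set (Rn n)} (hK : IsConvexBody K) {ε : ℝ} (hε : 0 < ε) :
    ∃ (I : Type) (_ : Fintype I) (a : I → Rn n →L[ℝ] ℝ) (b : I → ℝ),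
      IsConvexBody (poly a b) ∧ hausdorffDist (poly a b) K ≤ ε := by
  classical
  obtain ⟨R, hR⟩ := hK.2.1.isBounded.subset_closedBall (0 : Rn n)
  let B : Set (Rn n) := {x | ∀ i, x i ∈ Set.Icc (-R) R}
  have hB : IsCompact B := by
    have h1 : IsCompact (Set.pi Set.univ (fun _ : Fin n => Set.Icc (-R) R)) :=
      isCompact_univ_pi fun _ => isCompact_Icc
    have h2 := ((EuclideanSpace.equiv (Fin n) ℝ).toHomeomorph.isCompact_preimage).2 h1
    convert h2 using 1
    ext x
    simp only [B, Set.mem_preimage, Set.mem_pi, Set.mem_univ, true_implies, Set.mem_ofPred_eq]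
    rfl
  have hKB : K ⊆ B := by
    intro x hx i
    have h1 := hR hx
    rw [mem_closedBall_zero_iff] at h1
    have h2 := PiLp.norm_apply_le x i
    rw [Real.norm_eq_abs] at h2
    exact abs_le.1 (h2.trans h1)
  have hC : IsCompact (B \ thickening ε K) := hB.diff isOpen_thickening
  have hsep : ∀ y : (B \ thickening ε K : Set (Rn n)), ∃ (f : Rn n →L[ℝ] ℝ) (u : ℝ),
      (∀ x ∈ K, f x < u) ∧ u < f y := by
    intro y
    have hy : (y : Rn n) ∉ K := fun h => y.2.2 (self_subset_thickening hε K h)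
    obtain ⟨f, u, h1, h2⟩ := geometric_hahn_banach_closed_point hK.2.2 hK.2.1.isClosed hy
    exact ⟨f, u, h1, h2⟩
  choose f u hfu1 hfu2 using hsep
  obtain ⟨t, ht⟩ := hC.elim_finite_subcover (fun y => {x | u y < f y x})
    (fun y => isOpen_lt continuous_const (f y).continuous)
    (fun y hy => Set.mem_iUnion.2 ⟨⟨y, hy⟩, hfu2 ⟨y, hy⟩⟩)
  let pr : Fin n → Rn n →L[ℝ] ℝ := fun i => EuclideanSpace.proj i
  refine ⟨(Fin n ⊕ Fin n) ⊕ t, inferInstance,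
    Sum.elim (Sum.elim pr (fun i => - pr i)) (fun y => f y),
    Sum.elim (fun _ => R) (fun y => u y), ?_⟩
  set P := poly (Sum.elim (Sum.elim pr (fun i => - pr i)) (fun y : t => f y))
    (Sum.elim (fun _ => R) (fun y => u y)) with hP
  have hmem : ∀ x, x ∈ P ↔ x ∈ B ∧ ∀ y ∈ t, f y x ≤ u y := by
    intro x
    constructor
    · intro h
      have h1 : ∀ i, x i ≤ R := fun i => h (Sum.inl (Sum.inl i))
      have h2 : ∀ i, -(x i) ≤ R := fun i => h (Sum.inl (Sum.inr i))
      have h3 : ∀ y : t, f y x ≤ u y := fun y => h (Sum.inr y)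
      exact ⟨fun i => ⟨by linarith [h2 i], h1 i⟩, fun y hy => h3 ⟨y, hy⟩⟩
    · rintro ⟨h1, h3⟩ ((i | i) | y)
      · exact (h1 i).2
      · change -(x i) ≤ R
        linarith [(h1 i).1]
      · exact h3 y y.2
  have hKP : K ⊆ P := fun x hx => (hmem x).2 ⟨hKB hx, fun y _ => (hfu1 y x hx).le⟩
  have hPK : P ⊆ thickening ε K := by
    intro x hx
    by_contra hh
    have h1 := (hmem x).1 hx
    have h2 := ht ⟨h1.1, hh⟩
    simp only [Set.mem_iUnion] at h2
    obtain ⟨y, hy, h3⟩ := h2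
    exact absurd (h1.2 y hy) (not_le.2 h3)
  have hPclosed : IsClosed P := by
    rw [hP, poly, Set.ofPred_forall]
    exact isClosed_iInter fun i => isClosed_le (ContinuousLinearMap.continuous _) continuous_const
  have hPconv : Convex ℝ P := by
    rw [hP, poly, Set.ofPred_forall]
    exact convex_iInter fun i => convex_halfSpace_le
      (LinearMap.isLinear (ContinuousLinearMap.toLinearMap _)) _
  refine ⟨⟨hK.1.mono hKP, hB.of_isClosed_subset hPclosed fun x hx => ((hmem x).1 hx).1, hPconv⟩, ?_⟩
  apply hausdorffDist_le_of_mem_dist hε.le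
  · intro x hx
    obtain ⟨y, hy, hxy⟩ := mem_thickening_iff.1 (hPK hx)
    exact ⟨y, hy, hxy.le⟩
  · intro x hx
    exact ⟨x, hKP hx, by simpa using hε.le⟩

lemma hd_smul {K L : Set (Rn n)} (hK : IsConvexBody K) (hL : IsConvexBody L) {t : ℝ} (ht : 0 < t) :
    hausdorffDist (t • K) (t • L) ≤ t * hausdorffDist K L := by
  have hne : hausdorffEDist K L ≠ ⊤ :=
    hausdorffEDist_ne_top_of_nonempty_of_bounded hK.1 hL.1 hK.2.1.isBounded hL.2.1.isBounded
  have hne' : hausdorffEDist L K ≠ ⊤ :=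
    hausdorffEDist_ne_top_of_nonempty_of_bounded hL.1 hK.1 hL.2.1.isBounded hK.2.1.isBounded
  apply hausdorffDist_le_of_infDist (mul_nonneg ht.le hausdorffDist_nonneg)
  · rintro _ ⟨x, hx, rfl⟩
    simp only
    rw [infDist_smul₀ ht.ne', Real.norm_of_nonneg ht.le]
    exact mul_le_mul_of_nonneg_left (infDist_le_hausdorffDist_of_mem hx hne) ht.le
  · rintro _ ⟨x, hx, rfl⟩
    simp only
    rw [infDist_smul₀ ht.ne', Real.norm_of_nonneg ht.le, hausdorffDist_comm]
    exact mul_le_mul_of_nonneg_left (infDist_le_hausdorffDist_of_mem hx hne') ht.le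

lemma dil_cont (Φ : CurvatureMeasure n) {t : ℝ} (ht : 0 < t) (Ki : ℕ → Set (Rn n)) (K : Set (Rn n))
    (hKi : ∀ i, IsConvexBody (Ki i)) (hK : IsConvexBody K)
    (h : Tendsto (fun i => hausdorffDist (Ki i) K) atTop (𝓝 0))
    (f : BoundedContinuousFunction (Rn n) ℂ) :
    Tendsto (fun i => cmIntegral (dil t (Φ.meas (t • Ki i))) f) atTop
      (𝓝 (cmIntegral (dil t (Φ.meas (t • K))) f)) := by
  have h1 : ∀ L, cmIntegral (dil t (Φ.meas (t • L))) f =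
      cmIntegral (Φ.meas (t • L)) (f.compContinuous ⟨fun x => t⁻¹ • x, by fun_prop⟩) := by
    intro L
    rw [dil, cmIntegral_map _ _ (by fun_prop)]
    rfl
  simp only [h1]
  apply Φ.continuity _ _ (fun i => smul_body (hKi i)) (smul_body hK)
  have h2 := h.const_mul t
  rw [mul_zero] at h2
  exact squeeze_zero (fun _ => hausdorffDist_nonneg) (fun i => hd_smul (hKi i) hK ht) h2

end E


section F
variable {n : ℕ}

noncomputable def WW (n : ℕ) : Fin (n + 1) → Fin (n + 1) → ℝ := (exists_W n).choose

lemma WW_spec (k l : Fin (n + 1)) :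
    ∑ j, WW n k j * ((j : ℕ) + 1 : ℝ) ^ (l : ℕ) = if k = l then 1 else 0 :=
  (exists_W n).choose_spec k l

lemma WW_specC (k l : Fin (n + 1)) :
    ∑ j, (WW n k j : ℂ) * ((j : ℕ) + 1 : ℂ) ^ (l : ℕ) = if k = l then 1 else 0 := by
  have := congrArg (fun x : ℝ => (x : ℂ)) (WW_spec k l)
  rw [apply_ite (fun x : ℝ => (x : ℂ))] at this
  push_cast at this
  exact this

/-- extraction of a coefficient -/
lemma WW_extract (x : Fin (n + 1) → ℂ) (k : Fin (n + 1)) :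
    ∑ j : Fin (n + 1), (WW n k j : ℂ) * ∑ l : Fin (n + 1), ((j : ℕ) + 1 : ℂ) ^ (l : ℕ) * x l = x k := by
  simp only [Finset.mul_sum]
  rw [Finset.sum_comm]
  simp only [← mul_assoc, ← Finset.sum_mul, WW_specC]
  simp

noncomputable def compM (Φ : CurvatureMeasure n) (k : Fin (n + 1)) (K : Set (Rn n)) :
    ComplexMeasure (Rn n) :=
  ∑ j : Fin (n + 1), WW n k j • dil ((j : ℕ) + 1 : ℝ) (Φ.meas (((j : ℕ) + 1 : ℝ) • K))

lemma jpos (j : Fin (n + 1)) : (0 : ℝ) < (j : ℕ) + 1 := by positivity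

lemma compM_apply (Φ : CurvatureMeasure n) (k : Fin (n + 1)) (K : Set (Rn n)) {β : Set (Rn n)}
    (hβ : MeasurableSet β) : compM Φ k K β =
    ∑ j : Fin (n + 1), (WW n k j : ℂ) *
      Φ.meas (((j : ℕ) + 1 : ℝ) • K) (((j : ℕ) + 1 : ℝ) • β) := by
  rw [compM, vm_sum_apply]
  apply Finset.sum_congr rfl
  intro j _
  rw [dil_apply (jpos j).ne' _ hβ]

lemma compM_cont (Φ : CurvatureMeasure n) (k : Fin (n + 1)) (Ki : ℕ → Set (Rn n)) (K : Set (Rn n))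
    (hKi : ∀ i, IsConvexBody (Ki i)) (hK : IsConvexBody K)
    (h : Tendsto (fun i => hausdorffDist (Ki i) K) atTop (𝓝 0))
    (f : BoundedContinuousFunction (Rn n) ℂ) :
    Tendsto (fun i => cmIntegral (compM Φ k (Ki i)) f) atTop
      (𝓝 (cmIntegral (compM Φ k K) f)) := by
  simp only [compM, cmIntegral_sum, cmIntegral_smul]
  apply tendsto_finsetSum
  intro j _
  exact (dil_cont Φ (jpos j) Ki K hKi hK h f).const_mul _

noncomputable def comp (Φ : CurvatureMeasure n) (k : Fin (n + 1)) : CurvatureMeasure n where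
  meas := compM Φ k
  locality := by
    intro K L U hK hL hU h β hβ hβU
    rw [compM_apply _ _ _ hβ, compM_apply _ _ _ hβ]
    apply Finset.sum_congr rfl
    intro j _
    congr 1
    apply Φ.locality _ _ (((j : ℕ) + 1 : ℝ) • U) (smul_body hK) (smul_body hL)
      (hU.smul₀ (jpos j).ne') _ _ (smul_meas (jpos j).ne' hβ) (Set.smul_set_mono hβU)
    rw [← Set.smul_set_inter₀ (jpos j).ne', ← Set.smul_set_inter₀ (jpos j).ne', h]
  translation_invariant := by
    intro K hK x β hβ
    have e : ∀ (t : ℝ) (A : Set (Rn n)), t • (tr x A) = tr (t • x) (t • A) := by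
      intro t A
      ext y
      constructor
      · rintro ⟨_, ⟨z, hz, rfl⟩, rfl⟩
        exact ⟨t • z, ⟨z, hz, rfl⟩, by simp⟩
      · rintro ⟨_, ⟨z, hz, rfl⟩, rfl⟩
        exact ⟨z + x, ⟨z, hz, rfl⟩, by simp⟩
    change compM Φ k (tr x K) (tr x β) = _
    rw [compM_apply _ _ _ (tr_meas x hβ), compM_apply _ _ _ hβ]
    apply Finset.sum_congr rfl
    intro j _
    rw [e, e]
    congr 1
    exact Φ.translation_invariant _ (smul_body hK) _ _ (smul_meas (jpos j).ne' hβ)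
  continuity := by
    intro Ki K hKi hK h f
    exact compM_cont Φ k Ki K hKi hK h f

lemma rel_poly {I : Type} [Fintype I] (Φ : CurvatureMeasure n) (a : I → Rn n →L[ℝ] ℝ) (b : I → ℝ)
    (h1 : IsConvexBody (poly a b)) (m : ℕ) (hm : 0 < m) :
    dil (m : ℝ) (Φ.meas ((m : ℝ) • poly a b))
      = ∑ k : Fin (n + 1), ((m : ℝ) ^ (k : ℕ)) • compM Φ k (poly a b) := by
  obtain ⟨ν, hν⟩ := poly_rel Φ a b h1
  have : ∀ k, compM Φ k (poly a b) = ν k := by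
    intro k
    ext β hβ
    rw [compM, vm_sum_apply, ← WW_extract (fun l => ν l β) k]
    apply Finset.sum_congr rfl
    intro j _
    have := hν (j + 1) (Nat.succ_pos _)
    rw [Nat.cast_add, Nat.cast_one] at this
    rw [this, vm_sum_apply]
    push_cast
    rfl
  simp only [this]
  exact hν m hm

lemma rel_gen (Φ : CurvatureMeasure n) {K : Set (Rn n)} (hK : IsConvexBody K) (m : ℕ)
    (hm : 0 < m) :
    dil (m : ℝ) (Φ.meas ((m : ℝ) • K))
      = ∑ k : Fin (n + 1), ((m : ℝ) ^ (k : ℕ)) • compM Φ k K := by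
  have hm' : (0 : ℝ) < m := by exact_mod_cast hm
  have hex : ∀ i : ℕ, ∃ P : Set (Rn n), IsConvexBody P ∧
      hausdorffDist P K ≤ 1 / ((i : ℝ) + 1) ∧ dil (m : ℝ) (Φ.meas ((m : ℝ) • P))
      = ∑ k : Fin (n + 1), ((m : ℝ) ^ (k : ℕ)) • compM Φ k P := by
    intro i
    obtain ⟨I, _, a, b, h1, h2⟩ := approx hK (ε := 1 / ((i : ℝ) + 1)) (by positivity)
    exact ⟨poly a b, h1, h2, rel_poly Φ a b h1 m hm⟩
  choose P hP1 hP2 hP3 using hex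
  have hlim : Tendsto (fun i => hausdorffDist (P i) K) atTop (𝓝 0) :=
    squeeze_zero (fun _ => hausdorffDist_nonneg) hP2 tendsto_one_div_add_atTop_nhds_zero_nat
  apply cm_ext
  intro f
  have t1 := dil_cont Φ hm' P K hP1 hK hlim f
  simp only [hP3] at t1
  refine tendsto_nhds_unique t1 ?_
  simp only [cmIntegral_sum, cmIntegral_smul]
  apply tendsto_finsetSum
  intro k _
  exact (compM_cont Φ k P K hP1 hK hlim f).const_mul _

lemma hom_nat (Φ : CurvatureMeasure n) (k : Fin (n + 1)) {K : Set (Rn n)} (hK : IsConvexBody K)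
    (m : ℕ) (hm : 0 < m) {β : Set (Rn n)} (hβ : MeasurableSet β) :
    compM Φ k ((m : ℝ) • K) ((m : ℝ) • β) = (m : ℂ) ^ (k : ℕ) * compM Φ k K β := by
  have hm' : (0 : ℝ) < m := by exact_mod_cast hm
  rw [compM_apply _ _ _ (smul_meas hm'.ne' hβ),
    ← WW_extract (fun l : Fin (n + 1) => (m : ℂ) ^ (l : ℕ) * compM Φ l K β) k]
  apply Finset.sum_congr rfl
  intro j _
  congr 1
  have h := rel_gen Φ hK ((j + 1) * m) (by positivity)
  have h2 := congrArg (fun μ : ComplexMeasure (Rn n) => μ β) h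
  rw [vm_sum_apply] at h2
  rw [dil_apply (by positivity) _ hβ] at h2
  push_cast at h2
  rw [smul_smul, smul_smul, h2]
  apply Finset.sum_congr rfl
  intro l _
  rw [mul_pow, mul_assoc]

lemma hom_rat (Φ : CurvatureMeasure n) (k : Fin (n + 1)) {K : Set (Rn n)} (hK : IsConvexBody K)
    (q : ℚ) (hq : 0 < q) {β : Set (Rn n)} (hβ : MeasurableSet β) :
    compM Φ k ((q : ℝ) • K) ((q : ℝ) • β) = ((q : ℝ) : ℂ) ^ (k : ℕ) * compM Φ k K β := by
  obtain ⟨a, ha⟩ : ∃ a : ℕ, (a : ℤ) = q.num := ⟨q.num.toNat, Int.toNat_of_nonneg (Rat.num_pos.2 hq).le⟩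
  have hapos : 0 < a := by
    have := Rat.num_pos.2 hq
    omega
  have hb : (0 : ℝ) < q.den := by exact_mod_cast q.den_pos
  have hqe : (q : ℝ) = a * (q.den : ℝ)⁻¹ := by
    rw [Rat.cast_def, ← ha, Int.cast_natCast, div_eq_mul_inv]
  have hβ' : MeasurableSet ((q.den : ℝ)⁻¹ • β) := smul_meas (by positivity) hβ
  have h1 := hom_nat Φ k (smul_body (t := (q.den : ℝ)⁻¹) hK) a hapos hβ'
  have h2 := hom_nat Φ k (smul_body (t := (q.den : ℝ)⁻¹) hK) q.den q.den_pos hβ'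
  rw [smul_inv_smul₀ hb.ne', smul_inv_smul₀ hb.ne'] at h2
  rw [smul_smul, smul_smul, ← hqe] at h1
  rw [h1, h2]
  have hb' : (q.den : ℂ) ≠ 0 := by exact_mod_cast q.den_pos.ne'
  generalize compM Φ k ((q.den : ℝ)⁻¹ • K) ((q.den : ℝ)⁻¹ • β) = z
  have hqc : ((q : ℝ) : ℂ) = a * (q.den : ℂ)⁻¹ := by
    rw [hqe]; push_cast; rfl
  rw [hqc, mul_pow, inv_pow]
  field_simp

lemma hom_real (Φ : CurvatureMeasure n) (k : Fin (n + 1)) : (comp Φ k).Homogeneous (k : ℕ) := by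
  intro t ht K hK β hβ
  change compM Φ k (t • K) (t • β) = (t : ℂ) ^ (k : ℕ) * compM Φ k K β
  have hex : ∀ i : ℕ, ∃ q : ℚ, t < q ∧ (q : ℝ) < t + 1 / ((i : ℝ) + 1) := fun i =>
    exists_rat_btwn (by linarith [show (0 : ℝ) < 1 / ((i : ℝ) + 1) by positivity])
  choose q hq1 hq2 using hex
  have hqpos : ∀ i, (0 : ℝ) < q i := fun i => ht.trans (hq1 i)
  have hqlim : Tendsto (fun i => (q i : ℝ)) atTop (𝓝 t) := by
    refine tendsto_of_tendsto_of_tendsto_of_le_of_le tendsto_const_nhds ?_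
      (fun i => (hq1 i).le) (fun i => (hq2 i).le)
    simpa using tendsto_one_div_add_atTop_nhds_zero_nat.const_add t
  have key : compM Φ k (t • K) = (t ^ (k : ℕ)) • (compM Φ k K).map (fun x => t • x) := by
    apply cm_ext
    intro f
    rw [cmIntegral_smul, cmIntegral_map _ _ (by fun_prop)]
    have hrat : ∀ i, cmIntegral (compM Φ k ((q i : ℝ) • K)) f =
        (((q i : ℝ) ^ (k : ℕ) : ℝ) : ℂ) * cmIntegral (compM Φ k K) (fun x => f ((q i : ℝ) • x)) := by
      intro i
      have : compM Φ k ((q i : ℝ) • K) =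
          ((q i : ℝ) ^ (k : ℕ)) • (compM Φ k K).map (fun x => (q i : ℝ) • x) := by
        ext γ hγ
        rw [_root_.smul_apply, VectorMeasure.map_apply _ (by fun_prop) hγ]
        have h := hom_rat Φ k hK (q i) (by exact_mod_cast hqpos i)
          (smul_meas (inv_ne_zero (hqpos i).ne') hγ)
        rw [smul_inv_smul₀ (hqpos i).ne'] at h
        rw [h, Complex.real_smul, Set.preimage_smul₀ (hqpos i).ne']
        push_cast
        rfl
      rw [this, cmIntegral_smul, cmIntegral_map _ _ (by fun_prop)]
    have t1 : Tendsto (fun i => cmIntegral (compM Φ k ((q i : ℝ) • K)) f) atTop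
        (𝓝 (cmIntegral (compM Φ k (t • K)) f)) := by
      apply compM_cont Φ k _ _ (fun i => smul_body hK) (smul_body hK)
      obtain ⟨R, hR⟩ := hK.2.1.isBounded.subset_closedBall (0 : Rn n)
      have hR0 : ∀ x ∈ K, ‖x‖ ≤ |R| := fun x hx =>
        (mem_closedBall_zero_iff.1 (hR hx)).trans (le_abs_self R)
      have hb : ∀ i, hausdorffDist ((q i : ℝ) • K) (t • K) ≤ |(q i : ℝ) - t| * |R| := by
        intro i
        have hdist : ∀ x ∈ K, dist ((q i : ℝ) • x) (t • x) ≤ |(q i : ℝ) - t| * |R| := by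
          intro x hx
          rw [dist_eq_norm, ← sub_smul, norm_smul, Real.norm_eq_abs]
          exact mul_le_mul_of_nonneg_left (hR0 x hx) (abs_nonneg _)
        apply hausdorffDist_le_of_mem_dist (by positivity)
        · rintro _ ⟨x, hx, rfl⟩
          exact ⟨t • x, ⟨x, hx, rfl⟩, hdist x hx⟩
        · rintro _ ⟨x, hx, rfl⟩
          exact ⟨(q i : ℝ) • x, ⟨x, hx, rfl⟩, by rw [dist_comm]; exact hdist x hx⟩
      refine squeeze_zero (fun _ => hausdorffDist_nonneg) hb ?_
      have := ((hqlim.sub_const t).abs).mul_const |R|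
      simpa using this
    refine tendsto_nhds_unique t1 ?_
    simp only [hrat]
    apply Tendsto.mul
    · exact (Complex.continuous_ofReal.tendsto _).comp (hqlim.pow _)
    · exact cmIntegral_dilate _ f _ t hqlim
  rw [key, _root_.smul_apply, VectorMeasure.map_apply _ (by fun_prop) (smul_meas ht.ne' hβ),
    Complex.real_smul, Set.preimage_smul₀ ht.ne', inv_smul_smul₀ ht.ne']
  push_cast
  rfl

end F

/-- Kiderlen–Weil decomposition: every translation invariant curvature measure on ℝⁿ is
uniquely a sum of translation invariant curvature measures homogeneous of degrees 0,…,n. -/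
theorem curvatureMeasure_homogeneous_decomposition (n : ℕ) (Φ : CurvatureMeasure n) :
    (∃ Φs : Fin (n + 1) → CurvatureMeasure n,
      (∀ i : Fin (n + 1), (Φs i).Homogeneous (i : ℕ)) ∧
      ∀ K : Set (Rn n), IsConvexBody K → ∀ β : Set (Rn n), MeasurableSet β →
        Φ.meas K β = ∑ i, (Φs i).meas K β) ∧
    (∀ Φs Ψs : Fin (n + 1) → CurvatureMeasure n,
      (∀ i : Fin (n + 1), (Φs i).Homogeneous (i : ℕ)) →
      (∀ i : Fin (n + 1), (Ψs i).Homogeneous (i : ℕ)) →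
      (∀ K : Set (Rn n), IsConvexBody K → ∀ β : Set (Rn n), MeasurableSet β →
        ∑ i, (Φs i).meas K β = ∑ i, (Ψs i).meas K β) →
      ∀ i : Fin (n + 1), ∀ K : Set (Rn n), IsConvexBody K →
        ∀ β : Set (Rn n), MeasurableSet β → (Φs i).meas K β = (Ψs i).meas K β) := by
  constructor
  · refine ⟨fun k => comp Φ k, fun k => hom_real Φ k, ?_⟩
    intro K hK β hβ
    have h := rel_gen Φ hK 1 one_pos
    have h2 := congrArg (fun μ : ComplexMeasure (Rn n) => μ β) h
    rw [vm_sum_apply] at h2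
    rw [dil_apply (by norm_num) _ hβ] at h2
    simp only [Nat.cast_one, one_smul, one_pow, Complex.ofReal_one, one_mul] at h2
    exact h2
  · intro Φs Ψs hΦ hΨ h i K hK β hβ
    rw [← WW_extract (fun l => (Φs l).meas K β) i, ← WW_extract (fun l => (Ψs l).meas K β) i]
    apply Finset.sum_congr rfl
    intro j _
    congr 1
    have h1 := h (((j : ℕ) + 1 : ℝ) • K) (smul_body hK) (((j : ℕ) + 1 : ℝ) • β)
      (smul_meas (jpos j).ne' hβ)
    have e1 : ∀ l, (Φs l).meas (((j : ℕ) + 1 : ℝ) • K) (((j : ℕ) + 1 : ℝ) • β) =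
        ((j : ℕ) + 1 : ℂ) ^ (l : ℕ) * (Φs l).meas K β := by
      intro l
      rw [hΦ l _ (jpos j) K hK β hβ]; push_cast; rfl
    have e2 : ∀ l, (Ψs l).meas (((j : ℕ) + 1 : ℝ) • K) (((j : ℕ) + 1 : ℝ) • β) =
        ((j : ℕ) + 1 : ℂ) ^ (l : ℕ) * (Ψs l).meas K β := by
      intro l
      rw [hΨ l _ (jpos j) K hK β hβ]; push_cast; rfl
    simp only [e1, e2] at h1
    exact h1
end

section
/- Let Φ be a translation invariant curvature measure on ℝⁿ. Then Φ is a valuation with values in measures: for all convex bodies K and L such that K ∪ L is convex, Φ(K ∪ L, β) + Φ(K ∩ L, β) = Φ(K, β) + Φ(L, β) for every Borel set β ⊆ ℝⁿ. -/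
open MeasureTheory Metric Filter Topology
open scoped Pointwise

/-- Integral against a signed measure. -/
noncomputable def smInt {n : ℕ} (s : SignedMeasure (Rn n)) (f : Rn n → ℝ) : ℝ :=
  (∫ x, f x ∂s.toJordanDecomposition.posPart) - (∫ x, f x ∂s.toJordanDecomposition.negPart)

lemma cmIntegral_ofReal {n : ℕ} (μ : ComplexMeasure (Rn n)) (f : Rn n → ℝ) :
    cmIntegral μ (fun x => (f x : ℂ)) =
      (smInt (ComplexMeasure.re μ) f : ℂ) + Complex.I * (smInt (ComplexMeasure.im μ) f : ℂ) := by
  unfold cmIntegral smInt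
  simp only [integral_complex_ofReal]
  push_cast
  rfl

lemma sm_apply {n : ℕ} (s : SignedMeasure (Rn n)) (β : Set (Rn n)) (hβ : MeasurableSet β) :
    s β = s.toJordanDecomposition.posPart.real β - s.toJordanDecomposition.negPart.real β := by
  conv_lhs => rw [← s.toSignedMeasure_toJordanDecomposition]
  unfold JordanDecomposition.toSignedMeasure
  rw [VectorMeasure.sub_apply, Measure.toSignedMeasure_apply_measurable hβ,
    Measure.toSignedMeasure_apply_measurable hβ]

lemma real_add4 {n : ℕ} (m1 m2 m3 m4 : Measure (Rn n)) [IsFiniteMeasure m1] [IsFiniteMeasure m2]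
    [IsFiniteMeasure m3] [IsFiniteMeasure m4] (β : Set (Rn n)) :
    (m1 + m2 + m3 + m4).real β = m1.real β + m2.real β + m3.real β + m4.real β := by
  rw [measureReal_add_apply, measureReal_add_apply, measureReal_add_apply]

lemma sm_eq_iff {n : ℕ} (s1 s2 s3 s4 : SignedMeasure (Rn n)) :
    (∀ β, MeasurableSet β → s1 β + s2 β = s3 β + s4 β) ↔
    s1.toJordanDecomposition.posPart + s2.toJordanDecomposition.posPart +
      s3.toJordanDecomposition.negPart + s4.toJordanDecomposition.negPart =
    s3.toJordanDecomposition.posPart + s4.toJordanDecomposition.posPart +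
      s1.toJordanDecomposition.negPart + s2.toJordanDecomposition.negPart := by
  constructor
  · intro h
    ext β hβ
    have := h β hβ
    rw [sm_apply _ _ hβ, sm_apply _ _ hβ, sm_apply _ _ hβ, sm_apply _ _ hβ] at this
    rw [← ENNReal.toReal_eq_toReal_iff' (measure_ne_top _ _) (measure_ne_top _ _)]
    change Measure.real _ _ = Measure.real _ _
    simp only [real_add4]
    linarith
  · intro h β hβ
    have := congrArg (fun m : Measure (Rn n) => m.real β) h
    simp only [real_add4] at this
    rw [sm_apply _ _ hβ, sm_apply _ _ hβ, sm_apply _ _ hβ, sm_apply _ _ hβ]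
    linarith

lemma int_add4 {n : ℕ} (m1 m2 m3 m4 : Measure (Rn n)) [IsFiniteMeasure m1] [IsFiniteMeasure m2]
    [IsFiniteMeasure m3] [IsFiniteMeasure m4] (f : BoundedContinuousFunction (Rn n) ℝ) :
    ∫ x, f x ∂(m1 + m2 + m3 + m4) =
      ∫ x, f x ∂m1 + ∫ x, f x ∂m2 + ∫ x, f x ∂m3 + ∫ x, f x ∂m4 := by
  rw [integral_add_measure (f.integrable _) (f.integrable _),
    integral_add_measure (f.integrable _) (f.integrable _),
    integral_add_measure (f.integrable _) (f.integrable _)]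

lemma sm_eq_iff_int {n : ℕ} (s1 s2 s3 s4 : SignedMeasure (Rn n)) :
    (∀ β, MeasurableSet β → s1 β + s2 β = s3 β + s4 β) ↔
    ∀ f : BoundedContinuousFunction (Rn n) ℝ, smInt s1 f + smInt s2 f = smInt s3 f + smInt s4 f := by
  rw [sm_eq_iff]
  constructor
  · intro h f
    have := congrArg (fun m : Measure (Rn n) => ∫ x, f x ∂m) h
    simp only [int_add4] at this
    unfold smInt
    linarith
  · intro h
    apply ext_of_forall_integral_eq_of_IsFiniteMeasure
    intro f
    have := h f
    unfold smInt at this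
    rw [int_add4, int_add4]
    linarith

lemma cm_eq_iff {n : ℕ} (s1 s2 s3 s4 : ComplexMeasure (Rn n)) :
    (∀ β, MeasurableSet β → s1 β + s2 β = s3 β + s4 β) ↔
    ∀ f : BoundedContinuousFunction (Rn n) ℝ,
      cmIntegral s1 (fun x => (f x : ℂ)) + cmIntegral s2 (fun x => (f x : ℂ)) =
      cmIntegral s3 (fun x => (f x : ℂ)) + cmIntegral s4 (fun x => (f x : ℂ)) := by
  have h1 : (∀ β, MeasurableSet β → s1 β + s2 β = s3 β + s4 β) ↔
      (∀ β, MeasurableSet β → ComplexMeasure.re s1 β + ComplexMeasure.re s2 β =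
        ComplexMeasure.re s3 β + ComplexMeasure.re s4 β) ∧
      (∀ β, MeasurableSet β → ComplexMeasure.im s1 β + ComplexMeasure.im s2 β =
        ComplexMeasure.im s3 β + ComplexMeasure.im s4 β) := by
    have hr : ∀ (s : ComplexMeasure (Rn n)) β, ComplexMeasure.re s β = (s β).re := fun _ _ => rfl
    have hi : ∀ (s : ComplexMeasure (Rn n)) β, ComplexMeasure.im s β = (s β).im := fun _ _ => rfl
    simp only [hr, hi, Complex.ext_iff, Complex.add_re, Complex.add_im]
    exact ⟨fun h => ⟨fun β hβ => (h β hβ).1, fun β hβ => (h β hβ).2⟩,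
      fun h β hβ => ⟨h.1 β hβ, h.2 β hβ⟩⟩
  rw [h1, sm_eq_iff_int, sm_eq_iff_int, ← forall_and]
  apply forall_congr'
  intro f
  simp only [cmIntegral_ofReal, Complex.ext_iff]
  simp

lemma hausdorff_tendsto {n : ℕ} (C : ℕ → Set (Rn n)) (D : Set (Rn n)) (hD : D.Nonempty)
    (hC : ∀ i, IsCompact (C i)) (hanti : Antitone C) (hI : ⋂ i, C i = D) :
    Tendsto (fun i => hausdorffDist (C i) D) atTop (𝓝 0) := by
  rw [Metric.tendsto_atTop]
  intro ε hε
  obtain ⟨N, hN⟩ := exists_subset_nhds_of_isCompact' (V := C) (U := thickening (ε / 2) D)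
    (hanti.directed_ge) hC (fun i => (hC i).isClosed) (by
      intro x hx
      rw [hI] at hx
      exact isOpen_thickening.mem_nhds (self_subset_thickening (by positivity) _ hx))
  refine ⟨N, fun i hi => ?_⟩
  rw [Real.dist_eq, sub_zero, abs_of_nonneg hausdorffDist_nonneg]
  refine lt_of_le_of_lt (hausdorffDist_le_of_mem_dist (r := ε / 2) (by positivity) ?_ ?_)
    (by linarith)
  · intro x hx
    obtain ⟨y, hy, h⟩ := mem_thickening_iff.1 (hN (hanti hi hx))
    exact ⟨y, hy, h.le⟩
  · intro x hx
    refine ⟨x, ?_, by simp; positivity⟩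
    rw [← hI] at hx
    exact Set.mem_iInter.1 hx i

lemma local_val {n : ℕ} (Φ : CurvatureMeasure n) (M K L U V : Set (Rn n)) (hM : IsConvexBody M)
    (hK : IsConvexBody K) (hL : IsConvexBody L) (hKL : IsConvexBody (K ∩ L))
    (hU : IsOpen U) (hV : IsOpen V) (hKM : K ⊆ M) (hLM : L ⊆ M)
    (hKU : K ∩ U = M ∩ U) (hLV : L ∩ V = M ∩ V) (hUV : M ⊆ U ∪ V)
    (β : Set (Rn n)) (hβ : MeasurableSet β) :
    Φ.meas M β + Φ.meas (K ∩ L) β = Φ.meas K β + Φ.meas L β := by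
  have key1 : ∀ γ, MeasurableSet γ → γ ⊆ U →
      Φ.meas M γ + Φ.meas (K ∩ L) γ = Φ.meas K γ + Φ.meas L γ := by
    intro γ hγ hs
    rw [Φ.locality K M U hK hM hU hKU γ hγ hs, Φ.locality (K ∩ L) L U hKL hL hU ?_ γ hγ hs]
    ext x
    have := Set.ext_iff.1 hKU x
    have := @hLM x
    simp only [Set.mem_inter_iff] at *
    tauto
  have key2 : ∀ γ, MeasurableSet γ → γ ⊆ V →
      Φ.meas M γ + Φ.meas (K ∩ L) γ = Φ.meas K γ + Φ.meas L γ := by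
    intro γ hγ hs
    rw [Φ.locality L M V hL hM hV hLV γ hγ hs, Φ.locality (K ∩ L) K V hKL hK hV ?_ γ hγ hs,
      add_comm]
    ext x
    have := Set.ext_iff.1 hLV x
    have := @hKM x
    simp only [Set.mem_inter_iff] at *
    tauto
  have key3 : ∀ γ, MeasurableSet γ → γ ⊆ Mᶜ →
      Φ.meas M γ + Φ.meas (K ∩ L) γ = Φ.meas K γ + Φ.meas L γ := by
    intro γ hγ hs
    have e : ∀ A, IsConvexBody A → A ⊆ M → Φ.meas A γ = Φ.meas M γ := by
      intro A hA hAM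
      refine Φ.locality A M Mᶜ hA hM hM.2.1.isClosed.isOpen_compl ?_ γ hγ hs
      ext x
      have := @hAM x
      simp only [Set.mem_inter_iff, Set.mem_compl_iff]
      tauto
    rw [e K hK hKM, e L hL hLM, e _ hKL (Set.inter_subset_left.trans hKM)]
  have split : ∀ (μ : ComplexMeasure (Rn n)),
      μ β = μ (β ∩ U) + (μ ((β \ U) ∩ V) + μ ((β \ U) \ V)) := by
    intro μ
    have a : ∀ A B : Set (Rn n), MeasurableSet A → MeasurableSet B →
        μ A = μ (A ∩ B) + μ (A \ B) := by
      intro A B hA hB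
      rw [← VectorMeasure.of_union (Set.disjoint_sdiff_inter.symm) (hA.inter hB) (hA.diff hB),
        Set.inter_union_diff]
    rw [a β U hβ hU.measurableSet,
      a (β \ U) V (hβ.diff hU.measurableSet) hV.measurableSet]
  have hdU := hβ.diff hU.measurableSet
  have e1 := key1 (β ∩ U) (hβ.inter hU.measurableSet) Set.inter_subset_right
  have e2 := key2 ((β \ U) ∩ V) (hdU.inter hV.measurableSet) Set.inter_subset_right
  have e3 := key3 ((β \ U) \ V) (hdU.diff hV.measurableSet) (by
    intro x hx hxM
    rcases hUV hxM with h | h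
    · exact hx.1.2 h
    · exact hx.2 h)
  rw [split (Φ.meas M), split (Φ.meas (K ∩ L)), split (Φ.meas K), split (Φ.meas L)]
  linear_combination e1 + e2 + e3

lemma inter_nonempty {n : ℕ} (K L : Set (Rn n)) (hK : IsConvexBody K) (hL : IsConvexBody L)
    (hM : IsConvexBody (K ∪ L)) : (K ∩ L).Nonempty := by
  have := isPreconnected_closed_iff.1 hM.2.2.isPreconnected K L hK.2.1.isClosed hL.2.1.isClosed
    subset_rfl (hK.1.mono fun x hx => ⟨Or.inl hx, hx⟩) (hL.1.mono fun x hx => ⟨Or.inr hx, hx⟩)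
  exact this.mono fun x hx => hx.2

lemma iInter_thick {n : ℕ} (K M : Set (Rn n)) (hK : IsConvexBody K) (hKM : K ⊆ M) :
    ⋂ i : ℕ, (cthickening (1 / ((i : ℝ) + 1)) K ∩ M) = K := by
  apply Set.Subset.antisymm
  · intro x hx
    rw [hK.2.1.isClosed.mem_iff_infDist_zero hK.1]
    refine le_antisymm ?_ infDist_nonneg
    refine ge_of_tendsto' tendsto_one_div_add_atTop_nhds_zero_nat fun i => ?_
    have h := (Set.mem_iInter.1 hx i).1
    rw [mem_cthickening_iff] at h
    exact ENNReal.toReal_le_of_le_ofReal (by positivity) h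
  · intro x hx
    exact Set.mem_iInter.2 fun i => ⟨self_subset_cthickening _ hx, hKM hx⟩

lemma thick_anti {n : ℕ} (K M : Set (Rn n)) :
    Antitone (fun i : ℕ => cthickening (1 / ((i : ℝ) + 1)) K ∩ M) := by
  intro i j hij
  exact Set.inter_subset_inter_left _ (cthickening_mono (one_div_le_one_div_of_le (by positivity)
    (by simpa using hij)) _)

lemma thick_body {n : ℕ} (K M : Set (Rn n)) (hK : IsConvexBody K) (hM : IsConvexBody M)
    (hKM : K ⊆ M) (r : ℝ) : IsConvexBody (cthickening r K ∩ M) :=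
  ⟨hK.1.mono fun _ hx => ⟨self_subset_cthickening _ hx, hKM hx⟩,
    hM.2.1.inter_left isClosed_cthickening, (hK.2.2.cthickening r).inter hM.2.2⟩

/-- Weil's theorem: every translation invariant curvature measure is a valuation with values
in measures. -/
theorem curvatureMeasure_is_valuation (n : ℕ) (Φ : CurvatureMeasure n) :
    ∀ K L : Set (Rn n), IsConvexBody K → IsConvexBody L → IsConvexBody (K ∪ L) →
      ∀ β : Set (Rn n), MeasurableSet β →
        Φ.meas (K ∪ L) β + Φ.meas (K ∩ L) β = Φ.meas K β + Φ.meas L β := by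
  intro K L hK hL hM
  have hne := inter_nonempty K L hK hL hM
  have hKL : IsConvexBody (K ∩ L) :=
    ⟨hne, hK.2.1.inter hL.2.1, hK.2.2.inter hL.2.2⟩
  have hKM : K ⊆ K ∪ L := Set.subset_union_left
  have hLM : L ⊆ K ∪ L := Set.subset_union_right
  set M := K ∪ L with hMdef
  set A : ℕ → Set (Rn n) := fun i => cthickening (1 / ((i : ℝ) + 1)) K ∩ M with hA
  set B : ℕ → Set (Rn n) := fun i => cthickening (1 / ((i : ℝ) + 1)) L ∩ M with hB
  have bA : ∀ i, IsConvexBody (A i) := fun i => thick_body K M hK hM hKM _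
  have bB : ∀ i, IsConvexBody (B i) := fun i => thick_body L M hL hM hLM _
  have iA : ⋂ i, A i = K := iInter_thick K M hK hKM
  have iB : ⋂ i, B i = L := iInter_thick L M hL hLM
  have iAB : ⋂ i, (A i ∩ B i) = K ∩ L := by rw [Set.iInter_inter_distrib, iA, iB]
  have aA : Antitone A := thick_anti K M
  have aB : Antitone B := thick_anti L M
  have bAB : ∀ i, IsConvexBody (A i ∩ B i) := fun i =>
    ⟨hne.mono (iAB ▸ Set.iInter_subset _ i), (bA i).2.1.inter (bB i).2.1,
      (bA i).2.2.inter (bB i).2.2⟩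
  have hloc : ∀ i, ∀ β, MeasurableSet β →
      Φ.meas M β + Φ.meas (A i ∩ B i) β = Φ.meas (A i) β + Φ.meas (B i) β := by
    intro i
    have hpos : 0 < 1 / ((i : ℝ) + 1) := by positivity
    refine local_val Φ M (A i) (B i) (thickening (1 / ((i : ℝ) + 1)) K)
      (thickening (1 / ((i : ℝ) + 1)) L) hM (bA i) (bB i) (bAB i) isOpen_thickening
      isOpen_thickening Set.inter_subset_right Set.inter_subset_right ?_ ?_
      (Set.union_subset_union (self_subset_thickening hpos _) (self_subset_thickening hpos _))
    · ext x
      exact ⟨fun h => ⟨h.1.2, h.2⟩,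
        fun h => ⟨⟨thickening_subset_cthickening _ _ h.2, h.1⟩, h.2⟩⟩
    · ext x
      exact ⟨fun h => ⟨h.1.2, h.2⟩,
        fun h => ⟨⟨thickening_subset_cthickening _ _ h.2, h.1⟩, h.2⟩⟩
  rw [cm_eq_iff]
  intro f
  let g : BoundedContinuousFunction (Rn n) ℂ :=
    BoundedContinuousFunction.ofNormedAddCommGroup (fun x => (f x : ℂ))
      (Complex.continuous_ofReal.comp f.continuous) ‖f‖ (fun x => by
        rw [Complex.norm_real]; exact f.norm_coe_le_norm x)
  have tA := Φ.continuity A K bA hK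
    (hausdorff_tendsto A K hK.1 (fun i => (bA i).2.1) aA iA) g
  have tB := Φ.continuity B L bB hL
    (hausdorff_tendsto B L hL.1 (fun i => (bB i).2.1) aB iB) g
  have tAB := Φ.continuity (fun i => A i ∩ B i) (K ∩ L) bAB hKL
    (hausdorff_tendsto _ _ hne (fun i => (bAB i).2.1)
      (fun i j h => Set.inter_subset_inter (aA h) (aB h)) iAB) g
  refine tendsto_nhds_unique (tAB.const_add (cmIntegral (Φ.meas M) g)) ?_
  refine (tA.add tB).congr fun i => ?_
  exact ((cm_eq_iff _ _ _ _).1 (hloc i) f).symm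
end
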